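/- arXiv:2509.01693 — 3 statements merged into one kernel-verified Lean document; each statement's English description precedes it below -/
import Mathlib

section
/- Let d : ℕ with d ≥ 2, and assume ringKrullDim R = d, 𝔞 ≠ R, and 𝔞 has positive height. Then there is a surjective R-linear map from ⊕_{i ∈ ℤ} H^d_𝔪(R) onto H^{d+1}_{𝔪_T}(T𝔞), the (d+1)-st local cohomology of the extended Rees algebra T𝔞 (as a module over itself) at its maximal homogeneous ideal 𝔪_T, viewed as an R-module by restriction of scalars. -/
set_option synthInstance.maxHeartbeats 1000000
set_option maxHeartbeats 1000000

open LaurentPolynomial IsLocalRing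

section CocycleDescription

open CategoryTheory Limits Opposite

variable {B : Type} [CommRing B]

/-- The `i`-cocycles of `Hom(P, Y)`. -/
def homCocycles {X : ModuleCat.{0} B} (P : ProjectiveResolution X) (i : ℕ) (Y : ModuleCat.{0} B) :
    Submodule B (P.complex.X i ⟶ Y) where
  carrier := {f | P.complex.d (i + 1) i ≫ f = 0}
  add_mem' {f g} hf hg := by
    simp only [Set.mem_ofPred_eq] at *
    rw [Preadditive.comp_add, hf, hg, add_zero]
  zero_mem' := comp_zero
  smul_mem' c f hf := by
    simp only [Set.mem_ofPred_eq] at *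
    rw [Linear.comp_smul, hf, smul_zero]

noncomputable abbrev yonedaOp (Y : ModuleCat.{0} B) : ModuleCat.{0} B ⥤ (ModuleCat.{0} B)ᵒᵖ :=
  ((linearYoneda B (ModuleCat.{0} B)).obj Y).rightOp

noncomputable abbrev homComplexOp {X : ModuleCat.{0} B} (P : ProjectiveResolution X) (Y : ModuleCat.{0} B) :
    ChainComplex (ModuleCat.{0} B)ᵒᵖ ℕ :=
  ((yonedaOp Y).mapHomologicalComplex _).obj P.complex

noncomputable def homCocyclesDesc {X : ModuleCat.{0} B} (P : ProjectiveResolution X) (i : ℕ)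
    (Y : ModuleCat.{0} B) :
    (homComplexOp P Y).opcycles i ⟶ op (ModuleCat.of B (homCocycles P i Y)) :=
  (homComplexOp P Y).descOpcycles (A := op (ModuleCat.of B (homCocycles P i Y)))
    (ModuleCat.ofHom (homCocycles P i Y).subtype).op (i + 1) (ChainComplex.prev _ _) (by
      apply Quiver.Hom.unop_inj
      ext f
      exact f.2)

noncomputable def extClass {X : ModuleCat.{0} B} (P : ProjectiveResolution X) (i : ℕ)
    (Y : ModuleCat.{0} B) :
    homCocycles P i Y →ₗ[B] (((Ext B (ModuleCat.{0} B) i).obj (op X)).obj Y) :=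
  ModuleCat.Hom.hom (show ModuleCat.of B (homCocycles P i Y) ⟶ (((Ext B (ModuleCat.{0} B) i).obj (op X)).obj Y) from
    ((P.isoLeftDerivedObj (yonedaOp Y) i).hom ≫
      (homComplexOp P Y).homologyι i ≫ homCocyclesDesc P i Y).unop)


lemma pOpcycles_homCocyclesDesc {X : ModuleCat.{0} B} (P : ProjectiveResolution X) (i : ℕ)
    (Y : ModuleCat.{0} B) (f : homCocycles P i Y) :
    ((homComplexOp P Y).pOpcycles i).unop.hom ((homCocyclesDesc P i Y).unop.hom f) = f.1 := by
  have h := (homComplexOp P Y).p_descOpcycles (A := op (ModuleCat.of B (homCocycles P i Y)))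
    (ModuleCat.ofHom (homCocycles P i Y).subtype).op (i + 1) (ChainComplex.prev _ _) (by
      apply Quiver.Hom.unop_inj
      ext f
      exact f.2)
  exact congrArg (fun (k : (homComplexOp P Y).X i ⟶ op (ModuleCat.of B (homCocycles P i Y))) =>
    ModuleCat.Hom.hom k.unop f) h

lemma pOpcycles_unop_injective {X : ModuleCat.{0} B} (P : ProjectiveResolution X) (i : ℕ)
    (Y : ModuleCat.{0} B) :
    Function.Injective ((homComplexOp P Y).pOpcycles i).unop.hom :=
  (ModuleCat.mono_iff_injective _).1 inferInstance

lemma homCocyclesDesc_surjective {X : ModuleCat.{0} B} (P : ProjectiveResolution X) (i : ℕ)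
    (Y : ModuleCat.{0} B) : Function.Surjective (homCocyclesDesc P i Y).unop.hom := by
  intro w
  have h := (homComplexOp P Y).d_pOpcycles (i + 1) i
  refine ⟨⟨((homComplexOp P Y).pOpcycles i).unop.hom w, ?_⟩, ?_⟩
  · exact congrArg (fun k => k.unop.hom w) h
  · apply pOpcycles_unop_injective
    exact pOpcycles_homCocyclesDesc P i Y _

lemma extClass_surjective {X : ModuleCat.{0} B} (P : ProjectiveResolution X) (i : ℕ)
    (Y : ModuleCat.{0} B) : Function.Surjective (extClass P i Y) := by
  have h1 : Function.Surjective ((homComplexOp P Y).homologyι i).unop.hom :=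
    (ModuleCat.epi_iff_surjective _).1 inferInstance
  have h2 : Function.Surjective (P.isoLeftDerivedObj (yonedaOp Y) i).hom.unop.hom :=
    (ModuleCat.epi_iff_surjective _).1 inferInstance
  exact (h2.comp h1).comp (homCocyclesDesc_surjective P i Y)

lemma extClass_eq_zero_iff {X : ModuleCat.{0} B} (P : ProjectiveResolution X) (i : ℕ)
    (Y : ModuleCat.{0} B) (f : homCocycles P i Y) :
    extClass P i Y f = 0 ↔ ∃ g, P.complex.d i ((ComplexShape.down ℕ).next i) ≫ g = f.1 := by
  have h2 : Function.Injective (P.isoLeftDerivedObj (yonedaOp Y) i).hom.unop.hom :=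
    (ModuleCat.mono_iff_injective _).1 inferInstance
  let L := homComplexOp P Y
  let j := (ComplexShape.down ℕ).next i
  have h3 : (ShortComplex.mk _ _ (L.homologyι_comp_fromOpcycles i j)).Exact :=
    ShortComplex.exact_of_f_is_kernel _ (L.homologyIsKernel i j rfl)
  have h4 := (ShortComplex.moduleCat_exact_iff _).1 h3.unop
  have h5 : ∀ g, (L.pOpcycles i).unop.hom ((L.fromOpcycles i j).unop.hom g) =
      P.complex.d i j ≫ g := fun g =>
    congrArg (fun (k : L.X i ⟶ L.X j) => ModuleCat.Hom.hom k.unop g) (L.p_fromOpcycles i j)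
  have h6 : extClass P i Y f = (P.isoLeftDerivedObj (yonedaOp Y) i).hom.unop.hom
    ((L.homologyι i).unop.hom ((homCocyclesDesc P i Y).unop.hom f)) := rfl
  refine (iff_of_eq (congrArg (· = 0) h6)).trans ((map_eq_zero_iff _ h2).trans ?_)
  constructor
  · intro h
    obtain ⟨g, hg⟩ := h4 _ h
    refine ⟨g, ?_⟩
    rw [← pOpcycles_homCocyclesDesc, ← hg]
    exact (h5 g).symm
  · rintro ⟨g, hg⟩
    have : (homCocyclesDesc P i Y).unop.hom f = (L.fromOpcycles i j).unop.hom g := by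
      apply pOpcycles_unop_injective
      rw [pOpcycles_homCocyclesDesc, ← hg]
      exact (h5 g).symm
    rw [this]
    exact congrArg (fun k => k.unop.hom g) (L.homologyι_comp_fromOpcycles i j)

def homCocyclesComp {X X' : ModuleCat.{0} B} {P : ProjectiveResolution X} {P' : ProjectiveResolution X'}
    (φ : P.complex ⟶ P'.complex) (i : ℕ) (Y : ModuleCat.{0} B) :
    homCocycles P' i Y →ₗ[B] homCocycles P i Y where
  toFun f := ⟨φ.f i ≫ f.1, by
    show P.complex.d (i + 1) i ≫ φ.f i ≫ f.1 = 0
    rw [← φ.comm_assoc, show P'.complex.d (i + 1) i ≫ f.1 = 0 from f.2, comp_zero]⟩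
  map_add' f g := Subtype.ext (Preadditive.comp_add _ _ _ _ _ _)
  map_smul' c f := Subtype.ext (Linear.comp_smul _ _ _ _ _ _)

lemma extClass_naturality {X X' : ModuleCat.{0} B} (P : ProjectiveResolution X) (P' : ProjectiveResolution X')
    (φ : P.complex ⟶ P'.complex) (q : X ⟶ X')
    (w : φ ≫ P'.π = P.π ≫ (ChainComplex.single₀ _).map q) (i : ℕ)
    (Y : ModuleCat.{0} B) (f : homCocycles P' i Y) :
    (((Ext B (ModuleCat.{0} B) i).map q.op).app Y).hom (extClass P' i Y f) =
      extClass P i Y (homCocyclesComp φ i Y f) := by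
  have h := (yonedaOp Y).leftDerived_map_eq i q (P := P) (Q := P') φ w
  have h1 := congrArg (fun k => k.unop.hom (extClass P' i Y f)) h
  refine h1.trans ?_
  set ψ := ((yonedaOp Y).mapHomologicalComplex (ComplexShape.down ℕ)).map φ with hψ
  have h2 := HomologicalComplex.homologyι_naturality ψ i
  have h3 : HomologicalComplex.opcyclesMap ψ i ≫ homCocyclesDesc P' i Y =
      homCocyclesDesc P i Y ≫ (ModuleCat.ofHom (homCocyclesComp φ i Y)).op := by
    apply Quiver.Hom.unop_inj
    ext f
    apply pOpcycles_unop_injective P i Y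
    refine Eq.trans ?_ (pOpcycles_homCocyclesDesc P i Y _).symm
    have h4 := congrArg (fun (k : (homComplexOp P Y).X i ⟶ (homComplexOp P' Y).opcycles i) =>
      ModuleCat.Hom.hom k.unop ((homCocyclesDesc P' i Y).unop.hom f)) 
      (HomologicalComplex.p_opcyclesMap ψ i)
    refine h4.trans ?_
    exact congrArg (fun k => φ.f i ≫ k) (pOpcycles_homCocyclesDesc P' i Y f)
  have h5 : HomologicalComplex.homologyMap ψ i ≫ (P'.isoLeftDerivedObj (yonedaOp Y) i).inv ≫
      (P'.isoLeftDerivedObj (yonedaOp Y) i).hom ≫ (homComplexOp P' Y).homologyι i ≫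
        homCocyclesDesc P' i Y = (homComplexOp P Y).homologyι i ≫ homCocyclesDesc P i Y ≫
          (ModuleCat.ofHom (homCocyclesComp φ i Y)).op := by
    have h6 : (P'.isoLeftDerivedObj (yonedaOp Y) i).inv ≫
      (P'.isoLeftDerivedObj (yonedaOp Y) i).hom ≫ (homComplexOp P' Y).homologyι i ≫
        homCocyclesDesc P' i Y = (homComplexOp P' Y).homologyι i ≫ homCocyclesDesc P' i Y :=
      Iso.inv_hom_id_assoc _ _
    refine (congrArg (fun k => HomologicalComplex.homologyMap ψ i ≫ k) h6).trans ?_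
    rw [← h3]
    exact (Category.assoc _ _ _).symm.trans
      ((congrArg (fun k => k ≫ homCocyclesDesc P' i Y) h2).trans (Category.assoc _ _ _))
  exact congrArg (fun (k : (homComplexOp P Y).homology i ⟶ op (ModuleCat.of B (homCocycles P' i Y))) => 
    ModuleCat.Hom.hom ((P.isoLeftDerivedObj (yonedaOp Y) i).hom ≫ k).unop f) h5


/-- The quotient `B ⧸ I ^ n` as an object of the module category. -/
abbrev powQuot (I : Ideal B) (n : ℕ) : ModuleCat.{0} B := ModuleCat.of B (B ⧸ I ^ n)

def powQuotMap (I : Ideal B) {n m : ℕ} (h : n ≤ m) : powQuot I m ⟶ powQuot I n :=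
  ModuleCat.ofHom (Submodule.mapQ _ _ LinearMap.id (Ideal.pow_le_pow_right h))

noncomputable def powRes (I : Ideal B) (n : ℕ) : ProjectiveResolution (powQuot I n) :=
  projectiveResolution _

noncomputable def powResMap (I : Ideal B) {n m : ℕ} (h : n ≤ m) :
    (powRes I m).complex ⟶ (powRes I n).complex :=
  ProjectiveResolution.lift (powQuotMap I h) _ _

structure IsCocyclePresentation (I : Ideal B) (j : ℕ) {E N : ModuleCat.{0} B} (p : E ⟶ N) {H : Type}
    [AddCommGroup H] [Module B H] (Q : ∀ n, homCocycles (powRes I n) j N →ₗ[B] H) : Prop where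
  surj : ∀ h, ∃ n f, Q n f = h
  compat : ∀ {n m : ℕ} (h : n ≤ m) (f), Q m (homCocyclesComp (powResMap I h) j N f) = Q n f
  ker : ∀ {n j' : ℕ} (_ : (ComplexShape.down ℕ).next j = j') (f), Q n f = 0 → ∃ (m : ℕ) (h : n ≤ m) (e : homCocycles (powRes I m) j E)
    (g : (powRes I m).complex.X j' ⟶ N), (powResMap I h).f j ≫ f.1 =
      e.1 ≫ p + (powRes I m).complex.d j j' ≫ g
  zero_of_comp : ∀ {n : ℕ} (f) (e : homCocycles (powRes I n) j E), f.1 = e.1 ≫ p → Q n f = 0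
  zero_of_d : ∀ {n j' : ℕ} (_ : (ComplexShape.down ℕ).next j = j') (f) (g), f.1 =
    (powRes I n).complex.d j j' ≫ g → Q n f = 0

theorem exists_isCocyclePresentation_localCohomology (I : Ideal B) (i : ℕ) (M : ModuleCat.{0} B) :
    ∃ Q, IsCocyclePresentation I i (0 : ModuleCat.of B PUnit ⟶ M)
      (H := (localCohomology I i).obj M) Q := by
  let F : (ℕᵒᵖ)ᵒᵖ ⥤ ModuleCat.{0} B ⥤ ModuleCat.{0} B :=
    localCohomology.diagram (localCohomology.idealPowersDiagram I) i
  have hc : IsColimit (((evaluation _ _).obj M).mapCocone (colimit.cocone F)) :=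
    isColimitOfPreserves _ (colimit.isColimit F)
  let leg : ∀ n, ((Ext B (ModuleCat.{0} B) i).obj (op (powQuot I n))).obj M →ₗ[B]
    (localCohomology I i).obj M := fun n => ((colimit.ι F (op (op n))).app M).hom
  have hmap : ∀ {n m : ℕ} (h : n ≤ m) (x), leg m ((((Ext B (ModuleCat.{0} B) i).map (powQuotMap I h).op).app M).hom x)
    = leg n x := by
    intro n m h x
    have hw := colimit.w F (homOfLE h).op.op
    exact congrArg (fun k => (k.app M).hom x) hw
  have hcomp : ∀ {n m : ℕ} (h : n ≤ m) (f),
      extClass (powRes I m) i M (homCocyclesComp (powResMap I h) i M f) = 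
        (((Ext B (ModuleCat.{0} B) i).map (powQuotMap I h).op).app M).hom (extClass (powRes I n) i M f) := by
    intro n m h f
    exact (extClass_naturality _ _ _ _ (ProjectiveResolution.lift_commutes _ _ _) _ _ _).symm
  refine ⟨fun n => leg n ∘ₗ extClass (powRes I n) i M, ?_, ?_, ?_, ?_, ?_⟩
  · intro h
    obtain ⟨n, y, hy⟩ := Concrete.isColimit_exists_rep _ hc h
    obtain ⟨f, hf⟩ := extClass_surjective (powRes I n.unop.unop) i M y
    refine ⟨n.unop.unop, f, ?_⟩
    rw [LinearMap.comp_apply, hf]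
    exact hy
  · intro n m h f
    rw [LinearMap.comp_apply, hcomp h, hmap h]
    rfl
  · rintro n _ rfl f hf
    have h0 : leg n (extClass (powRes I n) i M f) = leg n 0 := hf.trans (map_zero _).symm
    obtain ⟨k, a, b, hab⟩ := Concrete.isColimit_exists_of_rep_eq _ hc _ _ h0
    have hm : n ≤ k.unop.unop := a.unop.unop.down.down
    refine ⟨k.unop.unop, hm, 0, ?_⟩
    have h1 : extClass (powRes I k.unop.unop) i M (homCocyclesComp (powResMap I hm) i M f) = 0 := by
      rw [hcomp hm]
      refine hab.trans ?_
      exact map_zero (((F.map b).app M).hom)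
    obtain ⟨g, hg⟩ := (extClass_eq_zero_iff _ _ _ _).1 h1
    exact ⟨g, by rw [comp_zero, zero_add, hg]; rfl⟩
  · intro n f e he
    rw [comp_zero] at he
    rw [show f = 0 from Subtype.ext he, map_zero]
  · rintro n _ rfl f g hg
    rw [LinearMap.comp_apply, (extClass_eq_zero_iff _ _ _ _).2 ⟨g, hg.symm⟩, map_zero]

end CocycleDescription

/-- A total additive relation which is single-valued at `0` comes from a linear map. -/
lemma exists_linearMap_of_rel {S X H : Type*} [CommRing S] [AddCommGroup X] [Module S X]
    [AddCommGroup H] [Module S H] (r : X → H → Prop)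
    (hadd : ∀ {x y a b}, r x a → r y b → r (x + y) (a + b))
    (hsmul : ∀ (c : S) {x a}, r x a → r (c • x) (c • a))
    (htot : ∀ x, ∃ a, r x a) (hzero : ∀ {a}, r 0 a → a = 0) :
    ∃ f : X →ₗ[S] H, ∀ x a, r x a ↔ f x = a := by
  have huniq : ∀ {x a b}, r x a → r x b → a = b := by
    intro x a b ha hb
    have := hadd ha (hsmul (-1) hb)
    simp only [neg_smul, one_smul, add_neg_cancel] at this
    exact add_neg_eq_zero.1 (hzero this)
  choose f hf using htot
  refine ⟨⟨⟨f, fun x y => huniq (hf _) (hadd (hf x) (hf y))⟩,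
    fun c x => huniq (hf _) (hsmul c (hf x))⟩, fun x a => ⟨fun h => huniq (hf x) h, ?_⟩⟩
  rintro rfl
  exact hf x

section DimensionShift

open CategoryTheory Limits Opposite

variable {B : Type} [CommRing B]

lemma exists_d_comp_eq_of_injective {X : ModuleCat.{0} B} (P : ProjectiveResolution X) (j : ℕ)
    (E : ModuleCat.{0} B) [Injective E] (e : P.complex.X (j + 1) ⟶ E)
    (he : P.complex.d (j + 2) (j + 1) ≫ e = 0) : ∃ g, P.complex.d (j + 1) j ≫ g = e :=
  ⟨(P.exact_succ j).descToInjective e he, (P.exact_succ j).comp_descToInjective e he⟩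

theorem IsCocyclePresentation.shift {I : Ideal B} {j : ℕ} {E₀ N : ModuleCat.{0} B} {p₀ : E₀ ⟶ N}
    {H : Type} [AddCommGroup H] [Module B H] {Q : ∀ n, homCocycles (powRes I n) (j + 1) N →ₗ[B] H}
    (hQ : IsCocyclePresentation I (j + 1) p₀ Q) [Injective E₀] {E N' : ModuleCat.{0} B}
    [Injective E] {ι : N ⟶ E} {π : E ⟶ N'} [Mono ι] [Epi π] {w : ι ≫ π = 0}
    (hex : (ShortComplex.mk ι π w).Exact) :
    ∃ Q', IsCocyclePresentation I j π (H := H) Q' := by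
  let r : ∀ n, homCocycles (powRes I n) j N' → H → Prop := fun n f a =>
    ∃ (g : (powRes I n).complex.X j ⟶ E) (k : homCocycles (powRes I n) (j + 1) N),
      g ≫ π = f.1 ∧ (powRes I n).complex.d (j + 1) j ≫ g = k.1 ≫ ι ∧ Q n k = a
  have hlift : ∀ n (g : (powRes I n).complex.X j ⟶ E),
      (powRes I n).complex.d (j + 1) j ≫ g ≫ π = 0 → ∃ k : homCocycles (powRes I n) (j + 1) N,
        (powRes I n).complex.d (j + 1) j ≫ g = k.1 ≫ ι := by
    intro n g hg
    have hg' : ((powRes I n).complex.d (j + 1) j ≫ g) ≫ π = 0 := by rw [Category.assoc, hg]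
    refine ⟨⟨hex.lift _ hg', ?_⟩, (hex.lift_f _ hg').symm⟩
    have : ((powRes I n).complex.d (j + 2) (j + 1) ≫ hex.lift _ hg') ≫ ι = 0 := by
      rw [Category.assoc, hex.lift_f _ hg', HomologicalComplex.d_comp_d_assoc, zero_comp]
    exact (cancel_mono ι).1 (this.trans zero_comp.symm)
  have hr : ∀ n, ∃ q : homCocycles (powRes I n) j N' →ₗ[B] H, ∀ f a, r n f a ↔ q f = a := by
    intro n
    apply exists_linearMap_of_rel (r n)
    · rintro x y a b ⟨g, k, h1, h2, rfl⟩ ⟨g', k', h1', h2', rfl⟩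
      refine ⟨g + g', k + k', ?_, ?_, map_add _ _ _⟩
      · rw [Preadditive.add_comp, h1, h1']; rfl
      · rw [Preadditive.comp_add, h2, h2', ← Preadditive.add_comp]; rfl
    · rintro c x a ⟨g, k, h1, h2, rfl⟩
      refine ⟨c • g, c • k, ?_, ?_, map_smul _ _ _⟩
      · rw [Linear.smul_comp, h1]; rfl
      · rw [Linear.comp_smul, h2, ← Linear.smul_comp]; rfl
    · intro f
      have hf : Projective.factorThru f.1 π ≫ π = f.1 := Projective.factorThru_comp _ _
      obtain ⟨k, hk⟩ := hlift n (Projective.factorThru f.1 π) (by rw [hf]; exact f.2)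
      exact ⟨_, _, k, hf, hk, rfl⟩
    · rintro a ⟨g, k, h1, h2, rfl⟩
      have hg : g ≫ π = 0 := h1
      refine hQ.zero_of_d (ChainComplex.next_nat_succ j) k (hex.lift g hg) ?_
      rw [← cancel_mono ι, ← h2, Category.assoc, hex.lift_f g hg]
  choose q hq using hr
  refine ⟨q, ?_, ?_, ?_, ?_, ?_⟩
  · intro h
    obtain ⟨n, k, rfl⟩ := hQ.surj h
    obtain ⟨g, hg⟩ := exists_d_comp_eq_of_injective (powRes I n) j E (k.1 ≫ ι) (by
      rw [← Category.assoc, show (powRes I n).complex.d (j + 2) (j + 1) ≫ k.1 = 0 from k.2,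
        zero_comp])
    refine ⟨n, ⟨g ≫ π, ?_⟩, (hq _ _ _).1 ⟨g, k, rfl, hg, rfl⟩⟩
    show (powRes I n).complex.d (j + 1) j ≫ g ≫ π = 0
    rw [reassoc_of% hg, w, comp_zero]
  · intro n m h f
    obtain ⟨g, k, h1, h2, h3⟩ := (hq n f _).2 rfl
    rw [← h3]
    refine (hq _ _ _).1 ⟨(powResMap I h).f j ≫ g, homCocyclesComp (powResMap I h) (j + 1) N k,
      ?_, ?_, hQ.compat h k⟩
    · rw [Category.assoc, h1]; rfl
    · rw [← HomologicalComplex.Hom.comm_assoc, h2]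
      exact (Category.assoc _ _ _).symm
  · intro n j' _ f hf
    obtain ⟨g, k, h1, h2, h3⟩ := (hq n f _).2 rfl
    obtain ⟨m, h, e, l, hl⟩ := hQ.ker (ChainComplex.next_nat_succ j) k (h3.trans hf)
    obtain ⟨e', he'⟩ := exists_d_comp_eq_of_injective (powRes I m) j E₀ e.1 e.2
    refine ⟨m, h, ⟨(powResMap I h).f j ≫ g - (e' ≫ p₀ + l) ≫ ι, ?_⟩, 0, ?_⟩
    · show (powRes I m).complex.d (j + 1) j ≫ _ = 0
      rw [Preadditive.comp_sub, ← HomologicalComplex.Hom.comm_assoc, h2, reassoc_of% hl,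
        ← Category.assoc _ _ ι, Preadditive.comp_add, ← Category.assoc _ e' p₀, he', sub_self]
    · rw [Preadditive.sub_comp, Category.assoc, Category.assoc, h1, w]
      simp
  · intro n f e he
    refine (hq _ _ _).1 ⟨e.1, 0, he.symm, ?_, map_zero _⟩
    exact (show (powRes I n).complex.d (j + 1) j ≫ e.1 = 0 from e.2).trans zero_comp.symm
  · intro n j' _ f g hg
    refine (hq _ _ _).1 ⟨(powRes I n).complex.d j j' ≫
      Projective.factorThru g π, 0, ?_, ?_, map_zero _⟩
    · rw [Category.assoc, Projective.factorThru_comp, hg]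
    · rw [HomologicalComplex.d_comp_d_assoc, zero_comp]
      exact zero_comp.symm

end DimensionShift

/-- The submodule of elements killed by a power of the ideal `I`. -/
def idealTorsion {B : Type*} [CommRing B] (I : Ideal B) (M : Type*) [AddCommGroup M] [Module B M] :
    Submodule B M where
  carrier := {v | ∃ n : ℕ, ∀ a ∈ I ^ n, a • v = 0}
  add_mem' {v w} := by
    rintro ⟨n, hn⟩ ⟨m, hm⟩
    refine ⟨n + m, fun a ha => ?_⟩
    rw [smul_add, hn a (Ideal.pow_le_pow_right (Nat.le_add_right n m) ha),
      hm a (Ideal.pow_le_pow_right (Nat.le_add_left m n) ha), add_zero]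
  zero_mem' := ⟨0, fun a _ => smul_zero a⟩
  smul_mem' c v := by
    rintro ⟨n, hn⟩
    exact ⟨n, fun a ha => by rw [smul_comm, hn a ha, smul_zero]⟩

section IdealTorsion

open CategoryTheory Limits Opposite

variable {B : Type} [CommRing B]

noncomputable def powResAug (I : Ideal B) (n : ℕ) : (powRes I n).complex.X 0 ⟶ powQuot I n :=
  (powRes I n).π.f 0

instance (I : Ideal B) (n : ℕ) : Epi (powResAug I n) :=
  inferInstanceAs (Epi ((powRes I n).π.f 0))

lemma d_powResAug (I : Ideal B) (n : ℕ) : (powRes I n).complex.d 1 0 ≫ powResAug I n = 0 :=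
  (powRes I n).complex_d_comp_π_f_zero

lemma powResMap_aug (I : Ideal B) {n m : ℕ} (h : n ≤ m) :
    (powResMap I h).f 0 ≫ powResAug I n = powResAug I m ≫ powQuotMap I h :=
  ProjectiveResolution.lift_commutes_zero _ _ _

noncomputable def zeroCocycle (I : Ideal B) (n : ℕ) {N : ModuleCat.{0} B} (f : powQuot I n ⟶ N) :
    homCocycles (powRes I n) 0 N :=
  ⟨powResAug I n ≫ f, by
    show (powRes I n).complex.d 1 0 ≫ powResAug I n ≫ f = 0
    rw [reassoc_of% d_powResAug, zero_comp]⟩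

lemma zeroCocycle_surjective (I : Ideal B) (n : ℕ) {N : ModuleCat.{0} B}
    (e : homCocycles (powRes I n) 0 N) : ∃ f, zeroCocycle I n f = e := by
  have h := (powRes I n).exact₀
  have : Epi ((powRes I n).π.f 0) := inferInstance
  exact ⟨h.desc e.1 e.2, Subtype.ext (h.g_desc e.1 e.2)⟩

lemma smul_eq_zero_of_powQuot {I : Ideal B} {n : ℕ} {N : ModuleCat.{0} B} (f : powQuot I n ⟶ N)
    {a : B} (ha : a ∈ I ^ n) : a • f.hom (Ideal.Quotient.mk _ 1) = 0 := by
  rw [← map_smul]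
  have : a • (Ideal.Quotient.mk (I ^ n) 1) = 0 := by
    rw [Algebra.smul_def, Ideal.Quotient.algebraMap_eq, ← map_mul, mul_one,
      Ideal.Quotient.eq_zero_iff_mem]
    exact ha
  exact (congrArg f.hom this).trans (map_zero _)

lemma exists_powQuot_hom {I : Ideal B} {n : ℕ} {N : ModuleCat.{0} B} (v : N)
    (hv : ∀ a ∈ I ^ n, a • v = 0) : ∃ f : powQuot I n ⟶ N, f.hom (Ideal.Quotient.mk _ 1) = v := by
  refine ⟨ModuleCat.ofHom (Submodule.liftQ (I ^ n) (LinearMap.toSpanSingleton B N v) ?_), ?_⟩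
  · intro a ha
    exact hv a ha
  · exact one_smul _ _

lemma powQuot_hom_ext {I : Ideal B} {n : ℕ} {N : ModuleCat.{0} B} {f g : powQuot I n ⟶ N}
    (h : f.hom (Ideal.Quotient.mk _ 1) = g.hom (Ideal.Quotient.mk _ 1)) : f = g := by
  refine ModuleCat.hom_ext (LinearMap.ext fun x => ?_)
  obtain ⟨x, rfl⟩ := Ideal.Quotient.mk_surjective x
  have : Ideal.Quotient.mk (I ^ n) x = x • Ideal.Quotient.mk (I ^ n) 1 := by
    rw [Algebra.smul_def, Ideal.Quotient.algebraMap_eq, ← map_mul, mul_one]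
  exact (congrArg f.hom this).trans ((map_smul f.hom _ _).trans ((congrArg (x • ·) h).trans
    ((map_smul g.hom _ _).symm.trans (congrArg g.hom this.symm))))

theorem IsCocyclePresentation.exists_idealTorsion {I : Ideal B} {E N : ModuleCat.{0} B} {p : E ⟶ N}
    {H : Type} [AddCommGroup H] [Module B H] {Q : ∀ n, homCocycles (powRes I n) 0 N →ₗ[B] H}
    (hQ : IsCocyclePresentation I 0 p Q) :
    ∃ c : idealTorsion I N →ₗ[B] H, Function.Surjective c ∧
      ∀ x, c x = 0 ↔ ∃ e ∈ idealTorsion I E, p.hom e = x := by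
  have hcompat : ∀ {n m : ℕ} (h : n ≤ m) (f : powQuot I n ⟶ N),
      Q m (zeroCocycle I m (powQuotMap I h ≫ f)) = Q n (zeroCocycle I n f) := by
    intro n m h f
    rw [← hQ.compat h]
    congr 1
    apply Subtype.ext
    show powResAug I m ≫ powQuotMap I h ≫ f = (powResMap I h).f 0 ≫ powResAug I n ≫ f
    rw [← Category.assoc, ← powResMap_aug, Category.assoc]
  let r : idealTorsion I N → H → Prop := fun v a => ∃ (n : ℕ) (f : powQuot I n ⟶ N),
    f.hom (Ideal.Quotient.mk _ 1) = v ∧ Q n (zeroCocycle I n f) = a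
  obtain ⟨c, hc⟩ := exists_linearMap_of_rel (S := B) r (by
      rintro x y a b ⟨n, f, h1, rfl⟩ ⟨m, g, h2, rfl⟩
      refine ⟨max n m, powQuotMap I (le_max_left _ _) ≫ f + powQuotMap I (le_max_right _ _) ≫ g,
        congrArg₂ (· + ·) h1 h2, ?_⟩
      rw [← hcompat (le_max_left n m) f, ← hcompat (le_max_right n m) g, ← map_add]
      exact congrArg _ (Subtype.ext (Preadditive.comp_add _ _ _ _ _ _))) (by
      rintro c x a ⟨n, f, h1, rfl⟩
      refine ⟨n, c • f, congrArg (c • ·) h1, ?_⟩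
      rw [← map_smul]
      exact congrArg _ (Subtype.ext (Linear.comp_smul _ _ _ _ _ _))) (by
      rintro ⟨v, n, hn⟩
      obtain ⟨f, hf⟩ := exists_powQuot_hom v hn
      exact ⟨_, n, f, hf, rfl⟩) (by
      rintro a ⟨n, f, h1, rfl⟩
      have : f = 0 := powQuot_hom_ext h1
      rw [this, ← map_zero (Q n)]
      exact congrArg _ (Subtype.ext comp_zero))
  refine ⟨c, ?_, ?_⟩
  · intro a
    obtain ⟨n, k, rfl⟩ := hQ.surj a
    obtain ⟨f, rfl⟩ := zeroCocycle_surjective I n k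
    exact ⟨⟨f.hom (Ideal.Quotient.mk _ 1), n, fun a ha => smul_eq_zero_of_powQuot f ha⟩,
      (hc _ _).1 ⟨n, f, rfl, rfl⟩⟩
  · intro x
    constructor
    · intro h
      obtain ⟨n, f, h1, h2⟩ := (hc x 0).2 h
      obtain ⟨m, hm, e, g, h3⟩ := hQ.ker (show (ComplexShape.down ℕ).next 0 = 0 by simp) _ h2
      rw [HomologicalComplex.shape _ _ _ (by simp), zero_comp, add_zero] at h3
      obtain ⟨e, rfl⟩ := zeroCocycle_surjective I m e
      refine ⟨e.hom (Ideal.Quotient.mk _ 1), ⟨m, fun a ha => smul_eq_zero_of_powQuot e ha⟩, ?_⟩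
      have h4 : powResAug I m ≫ powQuotMap I hm ≫ f = powResAug I m ≫ e ≫ p := by
        rw [← Category.assoc, ← powResMap_aug, Category.assoc, ← Category.assoc _ e p]
        exact h3
      have h5 := (cancel_epi _).1 h4
      rw [← h1]
      exact (congrArg (fun k => k.hom (Ideal.Quotient.mk (I ^ m) 1)) h5).symm
    · rintro ⟨e, ⟨n, hn⟩, h1⟩
      obtain ⟨e, rfl⟩ := exists_powQuot_hom e hn
      refine (hc _ _).1 ⟨n, e ≫ p, h1, hQ.zero_of_comp _ (zeroCocycle I n e) ?_⟩
      exact (Category.assoc _ _ _).symm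

/-- The cosyzygies of `M`. -/
noncomputable def cosyz (M : ModuleCat.{0} B) : ℕ → ModuleCat.{0} B
  | 0 => M
  | i + 1 => cokernel (Injective.ι (cosyz M i))

/-- The terms of an injective coresolution of `M`, shifted by one. -/
noncomputable def cosyzEnv (M : ModuleCat.{0} B) : ℕ → ModuleCat.{0} B
  | 0 => ModuleCat.of B PUnit
  | i + 1 => Injective.under (cosyz M i)

noncomputable def cosyzι (M : ModuleCat.{0} B) (i : ℕ) : cosyz M i ⟶ cosyzEnv M (i + 1) :=
  Injective.ι (cosyz M i)

noncomputable def cosyzπ (M : ModuleCat.{0} B) : ∀ i, cosyzEnv M i ⟶ cosyz M i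
  | 0 => 0
  | i + 1 => cokernel.π (Injective.ι (cosyz M i))

instance (M : ModuleCat.{0} B) (i : ℕ) : Mono (cosyzι M i) :=
  inferInstanceAs (Mono (Injective.ι _))

instance (M : ModuleCat.{0} B) (i : ℕ) : Epi (cosyzπ M (i + 1)) :=
  have h : Epi (cokernel.π (Injective.ι (cosyz M i))) := coequalizer.π_epi
  h

instance (M : ModuleCat.{0} B) (i : ℕ) : Injective (cosyzEnv M i) := by
  cases i with
  | zero => exact (ModuleCat.isZero_of_subsingleton (ModuleCat.of B PUnit)).injective
  | succ i => exact inferInstanceAs (Injective (Injective.under _))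

lemma cosyz_comp (M : ModuleCat.{0} B) (i : ℕ) : cosyzι M i ≫ cosyzπ M (i + 1) = 0 :=
  cokernel.condition _

lemma cosyz_exact (M : ModuleCat.{0} B) (i : ℕ) :
    (ShortComplex.mk _ _ (cosyz_comp M i)).Exact :=
  ShortComplex.exact_cokernel (Injective.ι (cosyz M i))

lemma cosyzι_injective (M : ModuleCat.{0} B) (i : ℕ) : Function.Injective (cosyzι M i).hom :=
  (ModuleCat.mono_iff_injective _).1 inferInstance

lemma cosyzπ_surjective (M : ModuleCat.{0} B) (i : ℕ) :
    Function.Surjective (cosyzπ M (i + 1)).hom :=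
  (ModuleCat.epi_iff_surjective _).1 inferInstance

lemma cosyzπ_cosyzι (M : ModuleCat.{0} B) (i : ℕ) (v : cosyz M i) :
    (cosyzπ M (i + 1)).hom ((cosyzι M i).hom v) = 0 :=
  congrArg (fun k => k.hom v) (cosyz_comp M i)

lemma exists_cosyzι_eq (M : ModuleCat.{0} B) (i : ℕ) (e : cosyzEnv M (i + 1))
    (he : (cosyzπ M (i + 1)).hom e = 0) : ∃ v, (cosyzι M i).hom v = e :=
  (ShortComplex.moduleCat_exact_iff _).1 (cosyz_exact M i) e he

lemma cosyzEnv_baer (M : ModuleCat.{0} B) (i : ℕ) : Module.Baer B (cosyzEnv M i) :=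
  have : Injective (ModuleCat.of B (cosyzEnv M i)) :=
    inferInstanceAs (Injective (cosyzEnv M i))
  Module.Baer.of_injective (Module.injective_module_of_injective_object B (cosyzEnv M i))

instance (M : ModuleCat.{0} B) : Subsingleton (cosyzEnv M 0) :=
  inferInstanceAs (Subsingleton PUnit)

theorem exists_idealTorsion_cosyz_localCohomology (I : Ideal B) (i : ℕ) (M : ModuleCat.{0} B) :
    ∃ c : idealTorsion I (cosyz M i) →ₗ[B] (localCohomology I i).obj M, Function.Surjective c ∧
      ∀ x, c x = 0 ↔ ∃ e ∈ idealTorsion I (cosyzEnv M i), (cosyzπ M i).hom e = x := by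
  have key : ∀ k j : ℕ, k + j = i → ∃ Q,
      IsCocyclePresentation I j (cosyzπ M k) (H := (localCohomology I i).obj M) Q := by
    intro k
    induction k with
    | zero =>
      rintro j rfl
      rw [zero_add]
      exact exists_isCocyclePresentation_localCohomology I j M
    | succ k ih =>
      intro j hj
      obtain ⟨Q, hQ⟩ := ih (j + 1) (by omega)
      exact hQ.shift (cosyz_exact M k)
  obtain ⟨Q, hQ⟩ := key i 0 rfl
  exact hQ.exists_idealTorsion

end IdealTorsion

lemma mem_idealTorsion_sup_span {B : Type*} [CommRing B] {I : Ideal B} {x : B} {M : Type*}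
    [AddCommGroup M] [Module B M] {v : M} :
    v ∈ idealTorsion (Ideal.span {x} ⊔ I) M ↔ v ∈ idealTorsion I M ∧ ∃ k : ℕ, x ^ k • v = 0 := by
  constructor
  · rintro ⟨n, hn⟩
    exact ⟨⟨n, fun a ha => hn a (Ideal.pow_right_mono le_sup_right n ha)⟩, n,
      hn _ (Ideal.pow_mem_pow (Ideal.mem_sup_left (Ideal.mem_span_singleton_self x)) n)⟩
  · rintro ⟨⟨n, hn⟩, k, hk⟩
    refine ⟨k + n, fun a ha => ?_⟩
    have h := Ideal.sup_pow_add_le_pow_sup_pow ha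
    rw [Ideal.span_singleton_pow, Submodule.mem_sup] at h
    obtain ⟨y, hy, z, hz, rfl⟩ := h
    obtain ⟨c, rfl⟩ := Ideal.mem_span_singleton'.1 hy
    rw [add_smul, mul_smul, hk, smul_zero, hn z hz, add_zero]

lemma idealTorsion_map {B : Type*} [CommRing B] {I : Ideal B} {M N : Type*}
    [AddCommGroup M] [Module B M] [AddCommGroup N] [Module B N] (f : M →ₗ[B] N) {v : M}
    (hv : v ∈ idealTorsion I M) : f v ∈ idealTorsion I N := by
  obtain ⟨n, hn⟩ := hv
  exact ⟨n, fun a ha => by rw [← map_smul, hn a ha, map_zero]⟩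

/-- Over a Noetherian ring, the `I`-torsion of an injective module is `x`-divisible up to
`x`-power torsion. -/
lemma exists_pow_smul_eq_of_baer {B : Type} [CommRing B] [IsNoetherianRing B] (I : Ideal B)
    {E : Type} [AddCommGroup E] [Module B E] (hE : Module.Baer B E) (x : B) (m : ℕ) {e : E}
    (he : e ∈ idealTorsion I E) :
    ∃ e' ∈ idealTorsion I E, ∃ q : ℕ, x ^ (q + m) • e' = x ^ q • e := by
  obtain ⟨n, hn⟩ := he
  obtain ⟨q, hq⟩ := monotone_stabilizes_iff_noetherian.2 ‹IsNoetherianRing B›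
    ⟨fun q => LinearMap.ker (LinearMap.mulLeft B (x ^ q)), by
      intro a b hab y hy
      obtain ⟨c, rfl⟩ := Nat.exists_eq_add_of_le hab
      simp only [LinearMap.mem_ker, LinearMap.mulLeft_apply] at hy ⊢
      rw [add_comm, pow_add, mul_assoc, hy, mul_zero]⟩
  have hker : ∀ b, x ^ (q + m) * b = 0 → x ^ q * b = 0 := by
    intro b hb
    have : b ∈ LinearMap.ker (LinearMap.mulLeft B (x ^ (q + m))) := hb
    have h2 := hq (q + m) (Nat.le_add_right q m)
    exact h2.ge this
  obtain ⟨k, hk⟩ := Ideal.exists_pow_inf_eq_pow_smul I (Ideal.span {x ^ (q + m)} : Ideal B)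
  have hAR : ∀ b, x ^ (q + m) * b ∈ I ^ (k + n) → ∃ a ∈ I ^ n, x ^ (q + m) * b = x ^ (q + m) * a := by
    intro b hb
    have h1 : x ^ (q + m) * b ∈ (I ^ (k + n) • ⊤ ⊓ Ideal.span {x ^ (q + m)} : Ideal B) := by
      refine ⟨?_, Ideal.mul_mem_right _ _ (Ideal.mem_span_singleton_self _)⟩
      rw [smul_eq_mul, Ideal.mul_top]
      exact hb
    rw [hk _ (Nat.le_add_right k n), Nat.add_sub_cancel_left] at h1
    have h2 : x ^ (q + m) * b ∈ I ^ n * Ideal.span {x ^ (q + m)} :=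
      Ideal.mul_mono_right (inf_le_right) h1
    obtain ⟨a, ha, h3⟩ := Ideal.mem_mul_span_singleton.1 h2
    exact ⟨a, ha, by rw [← h3, mul_comm]⟩
  let K : Ideal B := Ideal.span {x ^ (q + m)} ⊔ I ^ (k + n)
  obtain ⟨f, hf⟩ := exists_linearMap_of_rel (S := B) (X := K) (H := E)
    (fun y a => ∃ b, ∃ i ∈ I ^ (k + n), (y : B) = x ^ (q + m) * b + i ∧ a = (x ^ q * b) • e) (by
      rintro y y' _ _ ⟨b, i, hi, h1, rfl⟩ ⟨b', i', hi', h1', rfl⟩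
      refine ⟨b + b', i + i', add_mem hi hi', ?_, ?_⟩
      · rw [Submodule.coe_add, h1, h1']; ring
      · rw [mul_add, add_smul]) (by
      rintro c y _ ⟨b, i, hi, h1, rfl⟩
      refine ⟨c * b, c * i, Ideal.mul_mem_left _ _ hi, ?_, ?_⟩
      · rw [Submodule.coe_smul, h1, smul_eq_mul]; ring
      · rw [smul_smul]; congr 1; ring) (by
      rintro ⟨y, hy⟩
      obtain ⟨z, hz, i, hi, rfl⟩ := Submodule.mem_sup.1 hy
      obtain ⟨b, rfl⟩ := Ideal.mem_span_singleton'.1 hz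
      exact ⟨_, b, i, hi, congrArg (· + i) (mul_comm _ _), rfl⟩) (by
      rintro _ ⟨b, i, hi, h1, rfl⟩
      have h2 : x ^ (q + m) * b = -i := eq_neg_of_add_eq_zero_left h1.symm
      obtain ⟨a, ha, h3⟩ := hAR b (h2 ▸ neg_mem hi)
      have h4 := hker (b - a) (by rw [mul_sub, h3, sub_self])
      rw [mul_sub, sub_eq_zero] at h4
      rw [h4, mul_smul, hn a ha, smul_zero])
  obtain ⟨g, hg⟩ := hE K f
  refine ⟨g 1, ⟨k + n, fun a ha => ?_⟩, q, ?_⟩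
  · rw [← map_smul, smul_eq_mul, mul_one, hg a (Ideal.mem_sup_right ha)]
    exact (hf _ _).1 ⟨0, a, ha, by simp, by simp⟩
  · rw [← map_smul, smul_eq_mul, mul_one,
      hg _ (Ideal.mem_sup_left (Ideal.mem_span_singleton_self _))]
    exact (hf _ _).1 ⟨1, 0, zero_mem _, by simp, by simp⟩

/-- `q` presents `H` as the cokernel of `N → N_x`. -/
structure IsLocCokernel {B : Type} [CommRing B] (x : B) {N H : Type} [AddCommGroup N] [Module B N]
    [AddCommGroup H] [Module B H] (q : ℕ → (N →ₗ[B] H)) : Prop where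
  succ : ∀ m n, q (m + 1) (x • n) = q m n
  surj : ∀ h, ∃ m n, q m n = h
  zero : ∀ n, q 0 n = 0
  ker : ∀ {m n}, q m n = 0 → ∃ l n', x ^ l • n = x ^ (l + m) • n'

lemma IsLocCokernel.add {B : Type} [CommRing B] {x : B} {N H : Type} [AddCommGroup N] [Module B N]
    [AddCommGroup H] [Module B H] {q : ℕ → (N →ₗ[B] H)} (hq : IsLocCokernel x q) (m l : ℕ) (n : N) :
    q (m + l) (x ^ l • n) = q m n := by
  induction l generalizing n with
  | zero => simp
  | succ l ih => rw [pow_succ', mul_smul, ← add_assoc, hq.succ, ih]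

theorem exists_isLocCokernel {B : Type} [CommRing B] [IsNoetherianRing B] (I : Ideal B) (x : B)
    (i : ℕ) (M : ModuleCat.{0} B) (hI : Subsingleton ((localCohomology I (i + 1)).obj M)) :
    ∃ q, IsLocCokernel x (N := (localCohomology I i).obj M)
      (H := (localCohomology (Ideal.span {x} ⊔ I) (i + 1)).obj M) q := by
  obtain ⟨c, hc, hck⟩ := exists_idealTorsion_cosyz_localCohomology I i M
  obtain ⟨c₁, -, hck₁⟩ := exists_idealTorsion_cosyz_localCohomology I (i + 1) M
  obtain ⟨c', hc', hck'⟩ :=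
    exists_idealTorsion_cosyz_localCohomology (Ideal.span {x} ⊔ I) (i + 1) M
  set p₀ := (cosyzπ M i).hom
  set π := (cosyzπ M (i + 1)).hom
  set ι := (cosyzι M i).hom
  have hιinj : Function.Injective ι := cosyzι_injective M i
  have hπι : ∀ v, π (ι v) = 0 := cosyzπ_cosyzι M i
  have hexact : ∀ e, π e = 0 → ∃ v, ι v = e := exists_cosyzι_eq M i
  have hιtors : ∀ v, ι v ∈ idealTorsion I _ → v ∈ idealTorsion I _ := by
    rintro v ⟨n, hn⟩
    exact ⟨n, fun a ha => hιinj (by rw [map_smul, hn a ha, map_zero])⟩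
  have hlift : ∀ ν ∈ idealTorsion I (cosyz M (i + 1)), ∃ e ∈ idealTorsion I _, π e = ν :=
    fun ν hν => (hck₁ ⟨ν, hν⟩).1 (Subsingleton.elim _ _)
  let r : ℕ → (localCohomology I i).obj M →
      (localCohomology (Ideal.span {x} ⊔ I) (i + 1)).obj M → Prop := fun m n a =>
    ∃ (v : idealTorsion I (cosyz M i)) (e : cosyzEnv M (i + 1))
      (ν : idealTorsion (Ideal.span {x} ⊔ I) (cosyz M (i + 1))) (s : ℕ),
      e ∈ idealTorsion I _ ∧ π e = ν ∧ c v = n ∧ c' ν = a ∧ x ^ (s + m) • e = x ^ s • ι v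
  have hr : ∀ m, ∃ q : (localCohomology I i).obj M →ₗ[B]
      (localCohomology (Ideal.span {x} ⊔ I) (i + 1)).obj M, ∀ n a, r m n a ↔ q n = a := by
    intro m
    apply exists_linearMap_of_rel (r m)
    · rintro _ _ _ _ ⟨v, e, ν, s, he, h1, rfl, rfl, h2⟩ ⟨v', e', ν', s', he', h1', rfl, rfl, h2'⟩
      refine ⟨v + v', e + e', ν + ν', s + s', add_mem he he', ?_, map_add _ _ _, map_add _ _ _, ?_⟩
      · rw [map_add, h1, h1']; rfl
      · have h3 : x ^ (s + s' + m) • e = x ^ (s + s') • ι v := by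
          rw [show s + s' + m = s' + (s + m) by ring, pow_add, mul_smul, h2, smul_smul, ← pow_add,
            add_comm s']
        have h4 : x ^ (s + s' + m) • e' = x ^ (s + s') • ι v' := by
          rw [show s + s' + m = s + (s' + m) by ring, pow_add, mul_smul, h2', smul_smul, ← pow_add]
        rw [smul_add, h3, h4, ← smul_add, ← map_add]; rfl
    · rintro a _ _ ⟨v, e, ν, s, he, h1, rfl, rfl, h2⟩
      refine ⟨a • v, a • e, a • ν, s, Submodule.smul_mem _ _ he, ?_, map_smul _ _ _,
        map_smul _ _ _, ?_⟩
      · rw [map_smul, h1]; rfl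
      · rw [smul_comm, h2, smul_comm, ← map_smul]; rfl
    · intro n
      obtain ⟨v, rfl⟩ := hc n
      obtain ⟨e, he, s, hs⟩ := exists_pow_smul_eq_of_baer I (cosyzEnv_baer M (i + 1)) x m
        (idealTorsion_map ι v.2)
      refine ⟨_, v, e, ⟨π e, ?_⟩, s, he, rfl, rfl, rfl, hs⟩
      exact mem_idealTorsion_sup_span.2 ⟨idealTorsion_map π he, s + m, by
        rw [← map_smul, hs, map_smul, hπι, smul_zero]⟩
    · rintro _ ⟨v, e, ν, s, he, h1, h0, rfl, h2⟩
      obtain ⟨e₀, he₀, h3⟩ := (hck v).1 h0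
      obtain ⟨e₁, he₁, t, ht⟩ := exists_pow_smul_eq_of_baer I (cosyzEnv_baer M i) x m he₀
      refine (hck' ν).2 ⟨e - ι (p₀ e₁), ?_, ?_⟩
      · refine mem_idealTorsion_sup_span.2 ⟨sub_mem he (idealTorsion_map ι (idealTorsion_map p₀ he₁)),
          s + t + m, ?_⟩
        have h4 : x ^ (s + t + m) • e = x ^ (s + t) • ι v := by
          rw [show s + t + m = t + (s + m) by ring, pow_add, mul_smul, h2, smul_smul, ← pow_add,
            add_comm t]
        have h5 : x ^ (s + t + m) • ι (p₀ e₁) = x ^ (s + t) • ι v := by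
          rw [show s + t + m = s + (t + m) by ring, pow_add, mul_smul, ← map_smul ι,
            ← map_smul p₀, ht, map_smul, h3, map_smul, smul_smul, ← pow_add]
        rw [smul_sub, h4, h5, sub_self]
      · show π _ = _
        rw [map_sub, hπι, sub_zero, h1]
  choose q hq using hr
  refine ⟨q, ?_, ?_, ?_, ?_⟩
  · intro m n
    obtain ⟨v, e, ν, s, he, h1, h0, h2, h3⟩ := (hq m n _).2 rfl
    refine (hq _ _ _).1 ⟨x • v, e, ν, s, he, h1, by rw [map_smul, h0], h2, ?_⟩
    rw [← add_assoc, pow_succ', mul_smul, h3, smul_comm, ← map_smul]; rfl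
  · intro a
    obtain ⟨ν, rfl⟩ := hc' a
    obtain ⟨hν, k, hk⟩ := mem_idealTorsion_sup_span.1 ν.2
    obtain ⟨e, he, h1⟩ := hlift ν hν
    obtain ⟨v, hv⟩ := hexact (x ^ k • e) (by rw [map_smul, h1, hk])
    exact ⟨k, c ⟨v, hιtors v (hv ▸ Submodule.smul_mem _ _ he)⟩, (hq _ _ _).1
      ⟨_, e, ν, 0, he, h1, rfl, rfl, by rw [zero_add, pow_zero, one_smul, hv]⟩⟩
  · intro n
    obtain ⟨v, rfl⟩ := hc n
    exact (hq _ _ _).1 ⟨v, ι v, 0, 0, idealTorsion_map ι v.2, hπι _, rfl, map_zero _, rfl⟩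
  · intro m n hn
    obtain ⟨v, e, ν, s, he, h1, rfl, h2, h3⟩ := (hq m n _).2 rfl
    obtain ⟨e₁, he₁, h4⟩ := (hck' ν).1 (h2.trans hn)
    obtain ⟨he₁', k, hk⟩ := mem_idealTorsion_sup_span.1 he₁
    obtain ⟨w, hw⟩ := hexact (e - e₁) (by rw [map_sub, h1, sub_eq_zero]; exact h4.symm)
    refine ⟨k + s, c ⟨w, hιtors w (hw ▸ sub_mem he he₁')⟩, ?_⟩
    rw [← map_smul, ← map_smul]
    congr 1
    apply Subtype.ext
    apply hιinj
    show ι (x ^ (k + s) • v.1) = ι (x ^ (k + s + m) • w)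
    have h5 : x ^ (k + s + m) • e = x ^ (k + s) • ι v := by
      rw [show k + s + m = k + (s + m) by ring, pow_add, mul_smul, h3, smul_smul, ← pow_add]
    have h6 : x ^ (k + s + m) • e₁ = 0 := by
      rw [show k + s + m = (s + m) + k by ring, pow_add, mul_smul, hk, smul_zero]
    rw [map_smul, map_smul, hw, smul_sub, h5, h6, sub_zero]

/-- The ideal generated by the `k`-th powers of the entries of a list. -/
def powSpan {B : Type*} [CommRing B] (ys : List B) (k : ℕ) : Ideal B :=
  Ideal.span {z | ∃ y ∈ ys, z = y ^ k}

lemma powSpan_nil {B : Type*} [CommRing B] (k : ℕ) : powSpan ([] : List B) k = ⊥ := by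
  simp [powSpan]

lemma powSpan_cons {B : Type*} [CommRing B] (x : B) (ys : List B) (k : ℕ) :
    powSpan (x :: ys) k = Ideal.span {x ^ k} ⊔ powSpan ys k := by
  rw [powSpan, powSpan, ← Ideal.span_union]
  congr 1
  ext z
  simp

lemma prod_pow_mul_mem_powSpan {B : Type*} [CommRing B] {ys : List B} {k : ℕ} (a : ℕ) {z : B}
    (hz : z ∈ powSpan ys k) : ys.prod ^ a * z ∈ powSpan ys (k + a) := by
  induction hz using Submodule.span_induction with
  | mem z hz =>
    obtain ⟨y, hy, rfl⟩ := hz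
    obtain ⟨c, hc⟩ := List.dvd_prod hy
    rw [hc, mul_pow, mul_comm, ← mul_assoc, ← pow_add]
    exact Ideal.mul_mem_right _ _ (Ideal.subset_span ⟨y, hy, rfl⟩)
  | zero => rw [mul_zero]; exact zero_mem _
  | add x y _ _ hx hy => rw [mul_add]; exact add_mem hx hy
  | smul c x _ hx =>
    rw [smul_eq_mul, mul_left_comm]
    exact Ideal.mul_mem_left _ _ hx

/-- `q` presents `H` as the direct limit of `B / (y ^ m : y ∈ ys)` along multiplication by the
product of `ys`. -/
structure IsTopPresentation {B : Type} [CommRing B] (ys : List B) {H : Type} [AddCommGroup H]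
    [Module B H] (q : ℕ → (B →ₗ[B] H)) : Prop where
  succ : ∀ m v, q (m + 1) (ys.prod * v) = q m v
  surj : ∀ h, ∃ m v, q m v = h
  ker : ∀ {m v}, q m v = 0 → ∃ l, ys.prod ^ l * v ∈ powSpan ys (m + l)
  zero : ∀ {m v}, v ∈ powSpan ys m → q m v = 0

lemma IsTopPresentation.add {B : Type} [CommRing B] {ys : List B} {H : Type} [AddCommGroup H]
    [Module B H] {q : ℕ → (B →ₗ[B] H)} (hq : IsTopPresentation ys q) (m l : ℕ) (v : B) :
    q (m + l) (ys.prod ^ l * v) = q m v := by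
  induction l generalizing v with
  | zero => simp
  | succ l ih => rw [pow_succ', mul_assoc, ← add_assoc, hq.succ, ih]

lemma IsTopPresentation.cons {B : Type} [CommRing B] {ys : List B} {x : B} {N H : Type}
    [AddCommGroup N] [Module B N] [AddCommGroup H] [Module B H] {q : ℕ → (B →ₗ[B] N)}
    (hq : IsTopPresentation ys q) {q' : ℕ → (N →ₗ[B] H)} (hq' : IsLocCokernel x q') :
    IsTopPresentation (x :: ys) (fun m => q' m ∘ₗ q m) where
  succ m v := by
    rw [List.prod_cons, mul_assoc, LinearMap.comp_apply, ← smul_eq_mul x, map_smul, hq'.succ,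
      hq.succ]
    rfl
  surj h := by
    obtain ⟨a, n, rfl⟩ := hq'.surj h
    obtain ⟨b, v, rfl⟩ := hq.surj n
    refine ⟨a + b, x ^ b * (ys.prod ^ a * v), ?_⟩
    rw [LinearMap.comp_apply, ← smul_eq_mul (x ^ b), map_smul, hq'.add, add_comm a b, hq.add]
  ker {m v} h := by
    obtain ⟨l, n', h1⟩ := hq'.ker h
    obtain ⟨s, w, rfl⟩ := hq.surj n'
    have h2 : q (m + s) (x ^ l * (ys.prod ^ s * v) - x ^ (l + m) * (ys.prod ^ m * w)) = 0 := by
      rw [map_sub, ← smul_eq_mul (x ^ l), ← smul_eq_mul (x ^ (l + m)), map_smul, map_smul, hq.add,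
        add_comm m s, hq.add, h1, sub_self]
    obtain ⟨k, hk⟩ := hq.ker h2
    refine ⟨l + k + s, ?_⟩
    rw [powSpan_cons, List.prod_cons]
    have h3 := Ideal.mul_mem_left (powSpan ys (m + s + k + l)) (x ^ (k + s))
      (prod_pow_mul_mem_powSpan l hk)
    have h4 : (x * ys.prod) ^ (l + k + s) * v =
        (ys.prod ^ (l + k + m) * w) * x ^ (m + (l + k + s)) +
        x ^ (k + s) * (ys.prod ^ l * (ys.prod ^ k *
        (x ^ l * (ys.prod ^ s * v) - x ^ (l + m) * (ys.prod ^ m * w)))) := by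
      ring
    rw [h4]
    refine add_mem (Ideal.mem_sup_left (Ideal.mul_mem_left _ _
      (Ideal.mem_span_singleton_self _))) (Ideal.mem_sup_right ?_)
    rwa [show m + (l + k + s) = m + s + k + l by ring]
  zero {m v} hv := by
    rw [powSpan_cons] at hv
    obtain ⟨y, hy, z, hz, rfl⟩ := Submodule.mem_sup.1 hv
    obtain ⟨b, rfl⟩ := Ideal.mem_span_singleton'.1 hy
    rw [LinearMap.comp_apply, map_add, hq.zero hz, add_zero, mul_comm, ← smul_eq_mul, map_smul]
    have := hq'.add 0 m (q m b)
    rwa [zero_add, hq'.zero] at this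

lemma idealTorsion_bot {B : Type*} [CommRing B] {M : Type*} [AddCommGroup M] [Module B M] (v : M) :
    v ∈ idealTorsion (⊥ : Ideal B) M :=
  ⟨1, fun a ha => by rw [pow_one, Ideal.mem_bot] at ha; rw [ha, zero_smul]⟩

lemma exists_isTopPresentation_nil {B : Type} [CommRing B] :
    ∃ q, IsTopPresentation ([] : List B)
      (H := (localCohomology (⊥ : Ideal B) 0).obj (ModuleCat.of B B)) q := by
  obtain ⟨c, hc, hck⟩ := exists_idealTorsion_cosyz_localCohomology (⊥ : Ideal B) 0 (ModuleCat.of B B)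
  let e : B →ₗ[B] idealTorsion (⊥ : Ideal B) (cosyz (ModuleCat.of B B) 0) :=
    LinearMap.codRestrict (M₂ := B) _ LinearMap.id (fun v => idealTorsion_bot (M := B) v)
  refine ⟨fun _ => c ∘ₗ e, ⟨fun m v => by simp, fun h => ?_, fun {m v} h => ?_, fun {m v} h => ?_⟩⟩
  · obtain ⟨v, rfl⟩ := hc h
    exact ⟨0, v.1, rfl⟩
  · obtain ⟨e₀, -, he⟩ := (hck _).1 h
    refine ⟨0, ?_⟩
    rw [pow_zero, one_mul, powSpan_nil, Ideal.mem_bot]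
    rw [show e₀ = 0 from Subsingleton.elim _ _] at he
    exact he.symm.trans (map_zero _) |>.trans rfl
  · rw [powSpan_nil, Ideal.mem_bot] at h
    rw [h, map_zero]

lemma subsingleton_localCohomology_bot {B : Type} [CommRing B] (M : ModuleCat.{0} B) (i : ℕ) :
    Subsingleton ((localCohomology (⊥ : Ideal B) (i + 1)).obj M) := by
  obtain ⟨c, hc, hck⟩ := exists_idealTorsion_cosyz_localCohomology (⊥ : Ideal B) (i + 1) M
  refine subsingleton_of_forall_eq 0 fun h => ?_
  obtain ⟨v, rfl⟩ := hc h
  obtain ⟨e, he⟩ := cosyzπ_surjective M i v.1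
  exact (hck v).2 ⟨e, idealTorsion_bot e, he⟩

theorem subsingleton_localCohomology_ofList {B : Type} [CommRing B] [IsNoetherianRing B]
    (M : ModuleCat.{0} B) (ys : List B) {i : ℕ} (hi : ys.length < i) :
    Subsingleton ((localCohomology (Ideal.ofList ys) i).obj M) := by
  induction ys generalizing i with
  | nil =>
    obtain ⟨i, rfl⟩ := Nat.exists_eq_succ_of_ne_zero hi.ne'
    rw [Ideal.ofList_nil]
    exact subsingleton_localCohomology_bot M i
  | cons x ys ih =>
    obtain ⟨i, rfl⟩ := Nat.exists_eq_succ_of_ne_zero (Nat.ne_zero_of_lt hi)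
    rw [List.length_cons] at hi
    rw [Ideal.ofList_cons]
    have h1 := ih (i := i) (by omega)
    obtain ⟨q, hq⟩ := exists_isLocCokernel (Ideal.ofList ys) x i M (ih (by omega))
    refine subsingleton_of_forall_eq 0 fun h => ?_
    obtain ⟨m, n, rfl⟩ := hq.surj h
    rw [Subsingleton.elim n 0, map_zero]

theorem exists_isTopPresentation_ofList {B : Type} [CommRing B] [IsNoetherianRing B]
    (ys : List B) : ∃ q, IsTopPresentation ys
      (H := (localCohomology (Ideal.ofList ys) ys.length).obj (ModuleCat.of B B)) q := by
  induction ys with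
  | nil =>
    rw [Ideal.ofList_nil]
    exact exists_isTopPresentation_nil
  | cons x ys ih =>
    obtain ⟨q, hq⟩ := ih
    obtain ⟨q', hq'⟩ := exists_isLocCokernel (Ideal.ofList ys) x ys.length (ModuleCat.of B B)
      (subsingleton_localCohomology_ofList _ ys (Nat.lt_succ_self _))
    rw [Ideal.ofList_cons]
    exact ⟨_, hq.cons hq'⟩

theorem exists_isTopPresentation {B : Type} [CommRing B] [IsNoetherianRing B] {J : Ideal B}
    (ys : List B) (h : (Ideal.ofList ys).radical = J.radical) {d : ℕ} (hd : ys.length = d) :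
    ∃ q, IsTopPresentation ys (H := (localCohomology J d).obj (ModuleCat.of B B)) q := by
  subst hd
  obtain ⟨q, hq⟩ := exists_isTopPresentation_ofList ys
  let e := ((localCohomology.isoOfSameRadical h ys.length).app (ModuleCat.of B B)).toLinearEquiv
  refine ⟨fun m => e.toLinearMap ∘ₗ q m, ⟨fun m v => congrArg e (hq.succ m v), fun a => ?_,
    fun {m v} hv => hq.ker (e.map_eq_zero_iff.1 hv),
    fun {m v} hv => e.map_eq_zero_iff.2 (hq.zero hv)⟩⟩
  obtain ⟨m, v, hv⟩ := hq.surj (e.symm a)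
  exact ⟨m, v, e.symm_apply_eq.1 hv.symm |>.symm⟩

/-- Compare two direct limits presented by compatible families of additive maps. -/
lemma exists_linearMap_of_families {S X H H' : Type*} [CommRing S] [AddCommGroup X] [Module S X]
    [AddCommGroup H] [Module S H] [AddCommGroup H'] [Module S H'] (P : X → X)
    (φ : ℕ → (X →ₗ[S] H)) (ψ : ℕ → (X →ₗ[S] H')) (hφ : ∀ m x, φ (m + 1) (P x) = φ m x)
    (hψ : ∀ m x, ψ (m + 1) (P x) = ψ m x) (hsurj : ∀ h, ∃ m x, φ m x = h)
    (hker : ∀ m x, φ m x = 0 → ψ m x = 0) : ∃ f : H →ₗ[S] H', ∀ m x, f (φ m x) = ψ m x := by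
  have hφ' : ∀ l m x, φ (m + l) (P^[l] x) = φ m x := by
    intro l
    induction l with
    | zero => intro m x; rfl
    | succ l ih =>
      intro m x
      rw [Function.iterate_succ_apply', ← add_assoc, hφ, ih]
  have hψ' : ∀ l m x, ψ (m + l) (P^[l] x) = ψ m x := by
    intro l
    induction l with
    | zero => intro m x; rfl
    | succ l ih =>
      intro m x
      rw [Function.iterate_succ_apply', ← add_assoc, hψ, ih]
  obtain ⟨f, hf⟩ := exists_linearMap_of_rel (S := S) (X := H) (H := H')
    (fun h a => ∃ m x, φ m x = h ∧ ψ m x = a) (by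
      rintro _ _ _ _ ⟨m, x, rfl, rfl⟩ ⟨n, y, rfl, rfl⟩
      refine ⟨m + n, P^[n] x + P^[m] y, ?_, ?_⟩
      · rw [map_add, hφ', add_comm m n, hφ']
      · rw [map_add, hψ', add_comm m n, hψ']) (by
      rintro c _ _ ⟨m, x, rfl, rfl⟩
      exact ⟨m, c • x, map_smul _ _ _, map_smul _ _ _⟩) (by
      intro h
      obtain ⟨m, x, rfl⟩ := hsurj h
      exact ⟨_, m, x, rfl, rfl⟩) (by
      rintro _ ⟨m, x, h, rfl⟩
      exact hker m x h)
  exact ⟨f, fun m x => (hf _ _).1 ⟨m, x, rfl, rfl⟩⟩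

lemma coeff_C_mul_T {R : Type*} [CommRing R] (r : R) (n m : ℤ) :
    (C r * T n : R[T;T⁻¹]).coeff m = if n = m then r else 0 := by
  rw [← single_eq_C_mul_T, AddMonoidAlgebra.coeff_single, Finsupp.single_apply]

/-- The subring of Laurent polynomials whose coefficient in degree `n` lies in `𝔞 ^ n`. -/
def extendedRees {R : Type*} [CommRing R] (𝔞 : Ideal R) : Subalgebra R R[T;T⁻¹] where
  carrier := {f | ∀ n, f.coeff n ∈ 𝔞 ^ n.toNat}
  add_mem' hf hg n := add_mem (hf n) (hg n)
  mul_mem' {f g} hf hg n := by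
    rw [AddMonoidAlgebra.coeff_mul]
    refine Submodule.sum_mem _ fun i _ => Submodule.sum_mem _ fun j _ => ?_
    dsimp only
    split_ifs with h
    · refine Ideal.pow_le_pow_right (show n.toNat ≤ i.toNat + j.toNat by omega) ?_
      rw [pow_add]
      exact Ideal.mul_mem_mul (hf i) (hg j)
    · exact zero_mem _
  algebraMap_mem' r n := by
    rw [LaurentPolynomial.algebraMap_apply, C_apply]
    split_ifs with h
    · subst h
      simp
    · exact zero_mem _

section

variable {R : Type*} [CommRing R] {𝔞 : Ideal R}

lemma C_mul_T_mem_extendedRees {n : ℤ} {r : R} (h : r ∈ 𝔞 ^ n.toNat) :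
    C r * T n ∈ extendedRees 𝔞 := by
  intro m
  rw [coeff_C_mul_T]
  split_ifs with hm
  · rwa [← hm]
  · exact zero_mem _

/-- The monomial `r t ^ n` of the extended Rees algebra. -/
noncomputable def extendedRees.monomial (n : ℤ) (r : R) (h : r ∈ 𝔞 ^ n.toNat) : extendedRees 𝔞 :=
  ⟨C r * T n, C_mul_T_mem_extendedRees h⟩

/-- The element `t⁻¹` of the extended Rees algebra. -/
noncomputable def extendedRees.invT (𝔞 : Ideal R) : extendedRees 𝔞 :=
  extendedRees.monomial (-1) 1 (by simp)

lemma extendedRees.val_invT : (extendedRees.invT 𝔞 : R[T;T⁻¹]) = T (-1) := by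
  simp [extendedRees.invT, extendedRees.monomial]

lemma sum_coeff_C_mul_T (f : R[T;T⁻¹]) : f = ∑ n ∈ f.coeff.support, C (f.coeff n) * T n := by
  conv_lhs => rw [← AddMonoidAlgebra.sum_coeff_single f]
  simp_rw [← single_eq_C_mul_T]
  rfl

theorem adjoin_eq_extendedRees (𝔞 : Ideal R) :
    Algebra.adjoin R ({x : R[T;T⁻¹] | ∃ a ∈ 𝔞, C a * T 1 = x} ∪ {T (-1)}) = extendedRees 𝔞 := by
  apply le_antisymm
  · refine Algebra.adjoin_le ?_
    rintro _ (⟨a, ha, rfl⟩ | h)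
    · exact C_mul_T_mem_extendedRees (by simpa using ha)
    · rw [Set.mem_singleton_iff.1 h, ← extendedRees.val_invT (𝔞 := 𝔞)]
      exact (extendedRees.invT 𝔞).2
  · intro f hf
    rw [sum_coeff_C_mul_T f]
    refine sum_mem fun n hn => ?_
    clear hn
    have hr := hf n
    generalize f.coeff n = r at hr
    obtain ⟨k, rfl | rfl⟩ := Int.eq_nat_or_neg n
    · have this := hr
      rw [Int.toNat_natCast] at this
      clear hr
      induction k generalizing r with
      | zero =>
        rw [Nat.cast_zero, T_zero, mul_one]
        exact Subalgebra.algebraMap_mem _ r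
      | succ k ih =>
        rw [pow_succ] at this
        refine Submodule.mul_induction_on this (fun a ha b hb => ?_) (fun a b ha hb => ?_)
        · rw [map_mul, show (C a * C b * T ((k + 1 : ℕ) : ℤ) : R[T;T⁻¹]) = C a * T k * (C b * T 1) by
            rw [Nat.cast_succ, T_add]; ring]
          exact mul_mem (ih a ha) (Algebra.subset_adjoin (Or.inl ⟨b, hb, rfl⟩))
        · rw [map_add, add_mul]
          exact add_mem ha hb
    · rw [← smul_eq_C_mul]
      refine Subalgebra.smul_mem _ ?_ _
      rw [show (T (-(k : ℤ)) : R[T;T⁻¹]) = T (-1) ^ k by rw [T_pow]; congr 1; ring]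
      have hT : (T (-1) : R[T;T⁻¹]) ∈ Algebra.adjoin R
          ({x : R[T;T⁻¹] | ∃ a ∈ 𝔞, C a * T 1 = x} ∪ {T (-1)}) :=
        Algebra.subset_adjoin (Or.inr rfl)
      exact pow_mem hT _

/-- The homogeneous component of degree `n` of the extended Rees algebra. -/
def extendedRees.grade (𝔞 : Ideal R) (n : ℤ) : Submodule R (extendedRees 𝔞) where
  carrier := {f | ∀ m, m ≠ n → f.1.coeff m = 0}
  add_mem' hf hg m h := by
    exact (congrArg₂ (· + ·) (hf m h) (hg m h)).trans (add_zero _)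
  zero_mem' _ _ := rfl
  smul_mem' c f hf m h := by
    change c • f.1.coeff m = (0 : R)
    rw [hf m h, smul_zero]

lemma extendedRees.monomial_mem_grade (n : ℤ) (r : R) (h : r ∈ 𝔞 ^ n.toNat) :
    monomial n r h ∈ grade 𝔞 n := by
  intro m hm
  change (C r * T n : R[T;T⁻¹]).coeff m = 0
  rw [coeff_C_mul_T, if_neg hm.symm]

lemma extendedRees.eq_monomial {n : ℤ} {f : extendedRees 𝔞} (h : f ∈ grade 𝔞 n) :
    f = monomial n (f.1.coeff n) (f.2 n) := by
  refine Subtype.ext (LaurentPolynomial.ext fun m => ?_)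
  change _ = (C _ * T n : R[T;T⁻¹]).coeff m
  rw [coeff_C_mul_T]
  split_ifs with hm
  · rw [hm]
  · exact h m (Ne.symm hm)

instance : SetLike.GradedMonoid (extendedRees.grade 𝔞) where
  one_mem m hm := by
    change (1 : R[T;T⁻¹]).coeff m = 0
    rw [← T_zero, T_apply, if_neg hm.symm]
  mul_mem i j f g hf hg m hm := by
    rw [extendedRees.eq_monomial hf, extendedRees.eq_monomial hg]
    change (C _ * T i * (C _ * T j) : R[T;T⁻¹]).coeff m = 0
    rw [mul_mul_mul_comm, ← map_mul, ← T_add, coeff_C_mul_T, if_neg hm.symm]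

lemma extendedRees.isInternal_grade (𝔞 : Ideal R) : DirectSum.IsInternal (grade 𝔞) := by
  rw [DirectSum.isInternal_submodule_iff_iSupIndep_and_iSup_eq_top]
  constructor
  · rw [iSupIndep_def]
    intro n
    rw [Submodule.disjoint_def]
    intro f hf hf'
    have h : (⨆ m, ⨆ (_ : m ≠ n), grade 𝔞 m) ≤
        LinearMap.ker ((Finsupp.lapply n ∘ₗ (AddMonoidAlgebra.coeffLinearEquiv R).toLinearMap) ∘ₗ
          (extendedRees 𝔞).val.toLinearMap) := by
      refine iSup_le fun m => iSup_le fun hm g hg => hg n hm.symm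
    have h0 : f.1.coeff n = 0 := h hf'
    refine Subtype.ext (LaurentPolynomial.ext fun m => ?_)
    by_cases hm : m = n
    · rw [hm, h0]; rfl
    · exact hf m hm
  · rw [eq_top_iff]
    intro f _
    have : f = ∑ n ∈ f.1.coeff.support, monomial n (f.1.coeff n) (f.2 n) := by
      refine Subtype.ext ?_
      rw [AddSubmonoidClass.coe_finsetSum]
      exact sum_coeff_C_mul_T _
    rw [this]
    exact sum_mem fun n _ => Submodule.mem_iSup_of_mem n (monomial_mem_grade _ _ _)

noncomputable instance : GradedRing (extendedRees.grade 𝔞) where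
  __ := (extendedRees.isInternal_grade 𝔞).chooseDecomposition

end

/-- Adjoining a fraction `w` with `u * w ∈ B` for a nonzerodivisor `u ∈ B` does not increase the
Krull dimension. -/
lemma adjoin_insert_noetherian_and_dim_le {R A : Type*} [CommRing R] [CommRing A] [Algebra R A]
    (B : Subalgebra R A) [IsNoetherianRing B] (u w : A) (hu : u ∈ B) (hu' : u ∈ nonZeroDivisors A)
    (hw : u * w ∈ B) {n : ℕ} (hB : ringKrullDim B ≤ n) :
    IsNoetherianRing (Algebra.adjoin R (insert w (B : Set A))) ∧
      ringKrullDim (Algebra.adjoin R (insert w (B : Set A))) ≤ n := by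
  let φ : Polynomial B →ₐ[R] A := Polynomial.eval₂AlgHom B.val w fun _ => Commute.all _ _
  have hφ : Algebra.adjoin R (insert w (B : Set A)) = φ.range := by
    apply le_antisymm
    · refine Algebra.adjoin_le (Set.insert_subset ⟨Polynomial.X, by simp [φ]⟩ fun b hb =>
        ⟨Polynomial.C ⟨b, hb⟩, by simp [φ]⟩)
    · rintro _ ⟨p, rfl⟩
      change Polynomial.eval₂ _ _ p ∈ _
      rw [Polynomial.eval₂_eq_sum_range]
      have hw' : w ∈ Algebra.adjoin R (insert w (B : Set A)) := Algebra.subset_adjoin (Or.inl rfl)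
      exact sum_mem fun i _ => mul_mem (Algebra.subset_adjoin (Or.inr (p.coeff i).2))
        (pow_mem hw' _)
  rw [hφ]
  refine ⟨isNoetherianRing_of_surjective _ _ φ.rangeRestrict.toRingHom φ.rangeRestrict_surjective,
    ?_⟩
  have hub : (⟨u, hu⟩ : B) ∈ nonZeroDivisors B := by
    rw [mem_nonZeroDivisors_iff_right] at hu' ⊢
    intro x hx
    exact Subtype.ext (hu' _ (congrArg Subtype.val hx))
  have h1 : Polynomial.C (⟨u, hu⟩ : B) * Polynomial.X - Polynomial.C ⟨u * w, hw⟩ ∈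
      nonZeroDivisors (Polynomial B) := by
    rw [Polynomial.mem_nonZeroDivisors_iff]
    intro a ha
    have := congrArg (fun p => Polynomial.coeff p 1) ha
    rw [mem_nonZeroDivisors_iff_right] at hub
    apply hub
    simpa [Polynomial.coeff_C] using this
  have h2 := ringKrullDim_succ_le_of_surjective φ.rangeRestrict.toRingHom
    φ.rangeRestrict_surjective h1 (by
      refine Subtype.ext ?_
      simp [φ])
  rw [Polynomial.ringKrullDim_of_isNoetherianRing] at h2
  have h3 : ringKrullDim φ.range + 1 ≤ (n + 1 : ℕ) := by
    exact_mod_cast h2.trans (add_le_add_left hB 1)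
  rw [ENat.WithBot.add_one_le_natCast_iff] at h3
  exact ENat.WithBot.lt_add_one_iff.1 (by exact_mod_cast h3)

section

lemma T_mem_nonZeroDivisors {R : Type*} [CommRing R] (n : ℤ) :
    (T n : R[T;T⁻¹]) ∈ nonZeroDivisors R[T;T⁻¹] :=
  (isUnit_T n).mem_nonZeroDivisors

variable {R : Type*} [CommRing R] [IsNoetherianRing R] {𝔞 : Ideal R}

lemma adjoin_T_noetherian_and_dim_le {d : ℕ} (hd : ringKrullDim R ≤ d) (s : Finset R) :
    IsNoetherianRing (Algebra.adjoin R
      ((fun a => (C a * T 1 : R[T;T⁻¹])) '' s ∪ {T (-1)} : Set R[T;T⁻¹])) ∧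
    ringKrullDim (Algebra.adjoin R
      ((fun a => (C a * T 1 : R[T;T⁻¹])) '' s ∪ {T (-1)} : Set R[T;T⁻¹])) ≤ (d + 1 : ℕ) := by
  classical
  induction s using Finset.induction_on with
  | empty =>
    rw [Finset.coe_empty, Set.image_empty, Set.empty_union, Algebra.adjoin_singleton_eq_range_aeval]
    let φ : Polynomial R →ₐ[R] R[T;T⁻¹] := Polynomial.aeval (T (-1))
    refine ⟨isNoetherianRing_of_surjective _ _ φ.rangeRestrict.toRingHom
      φ.rangeRestrict_surjective,
      (ringKrullDim_le_of_surjective φ.rangeRestrict.toRingHom φ.rangeRestrict_surjective).trans ?_⟩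
    rw [Polynomial.ringKrullDim_of_isNoetherianRing]
    exact_mod_cast add_le_add_left hd 1
  | insert a s _ ih =>
    obtain ⟨h1, h2⟩ := ih
    have := adjoin_insert_noetherian_and_dim_le _ (T (-1)) (C a * T 1)
      (Algebra.subset_adjoin (Or.inr rfl)) (T_mem_nonZeroDivisors _) (by
        rw [T_mul, mul_T_assoc]
        rw [add_neg_cancel, T_zero, mul_one]
        exact Subalgebra.algebraMap_mem (Algebra.adjoin R _) a) h2
    rw [Algebra.adjoin_insert_adjoin, ← Set.insert_union] at this
    rwa [Finset.coe_insert, Set.image_insert_eq]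

theorem extendedRees_noetherian_and_dim_le {d : ℕ} (hd : ringKrullDim R ≤ d) (𝔞 : Ideal R) :
    IsNoetherianRing (extendedRees 𝔞) ∧ ringKrullDim (extendedRees 𝔞) ≤ (d + 1 : ℕ) := by
  obtain ⟨s, hs⟩ := IsNoetherian.noetherian 𝔞
  have h := adjoin_T_noetherian_and_dim_le hd s
  suffices h' : Algebra.adjoin R
      ((fun a => (C a * T 1 : R[T;T⁻¹])) '' s ∪ {T (-1)} : Set R[T;T⁻¹]) = extendedRees 𝔞 by
    rwa [h'] at h
  rw [← adjoin_eq_extendedRees]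
  apply le_antisymm
  · refine Algebra.adjoin_mono (Set.union_subset_union_left _ ?_)
    rintro _ ⟨a, ha, rfl⟩
    exact ⟨a, hs ▸ Ideal.subset_span ha, rfl⟩
  · refine Algebra.adjoin_le (Set.union_subset ?_
      (Set.subset_union_right.trans Algebra.subset_adjoin))
    rintro _ ⟨a, ha, rfl⟩
    rw [← hs] at ha
    induction ha using Submodule.span_induction with
    | mem x hx => exact Algebra.subset_adjoin (Or.inl ⟨x, hx, rfl⟩)
    | zero => simp
    | add x y _ _ hx hy =>
      rw [map_add, add_mul]
      exact add_mem hx hy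
    | smul c x _ hx =>
      rw [smul_eq_mul, map_mul, mul_assoc, ← smul_eq_C_mul]
      exact Subalgebra.smul_mem _ hx c

end

lemma Ideal.IsHomogeneous.of_mem_minimalPrimes {A σ : Type*} [CommRing A] [SetLike σ A]
    [AddSubmonoidClass σ A] {𝒜 : ℤ → σ} [GradedRing 𝒜] {I P : Ideal A} (hI : I.IsHomogeneous 𝒜)
    (hP : P ∈ I.minimalPrimes) : P.IsHomogeneous 𝒜 := by
  have h1 := hP.1.1.homogeneousCore (𝒜 := 𝒜)
  have h2 : I ≤ (P.homogeneousCore 𝒜).toIdeal := by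
    rw [← hI.toIdeal_homogeneousCore_eq_self]
    exact Ideal.homogeneousCore_mono 𝒜 hP.1.2
  rw [le_antisymm (hP.2 ⟨h1, h2⟩ (Ideal.toIdeal_homogeneousCore_le 𝒜 P))
    (Ideal.toIdeal_homogeneousCore_le 𝒜 P)]
  exact (P.homogeneousCore 𝒜).isHomogeneous

/-- There is no prime strictly between a prime `P` and a prime minimal over `P + (u)`. -/
lemma Ideal.not_lt_of_mem_minimalPrimes_sup_span {B : Type*} [CommRing B] [IsNoetherianRing B]
    {P Q P' : Ideal B} [hPp : P.IsPrime] [Q.IsPrime] {u : B}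
    (h : P' ∈ (P ⊔ Ideal.span {u}).minimalPrimes) (h1 : P < Q) : ¬ Q < P' := by
  intro h2
  have h3 := Ideal.map_height_le_one_of_mem_minimalPrimes h
  have hP' := h.1.1
  have hs := Ideal.Quotient.mk_surjective (I := P)
  have hk : ∀ J : Ideal B, P ≤ J → (J.map (Ideal.Quotient.mk P)).comap (Ideal.Quotient.mk P) = J := by
    intro J hJ
    rw [Ideal.comap_map_of_surjective _ hs, ← RingHom.ker_eq_comap_bot, Ideal.mk_ker,
      sup_eq_left.2 hJ]
  have p1 : (Q.map (Ideal.Quotient.mk P)).IsPrime :=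
    Ideal.map_isPrime_of_surjective hs (by rw [Ideal.mk_ker]; exact h1.le)
  have p2 : (P'.map (Ideal.Quotient.mk P)).IsPrime :=
    Ideal.map_isPrime_of_surjective hs (by rw [Ideal.mk_ker]; exact (h1.trans h2).le)
  have h4 : Q.map (Ideal.Quotient.mk P) < P'.map (Ideal.Quotient.mk P) := by
    refine lt_of_le_of_ne (Ideal.map_mono h2.le) fun h => h2.ne ?_
    rw [← hk Q h1.le, h, hk P' (h1.trans h2).le]
  have h5 : (⊥ : Ideal (B ⧸ P)) < Q.map (Ideal.Quotient.mk P) := by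
    rw [bot_lt_iff_ne_bot]
    intro h
    apply h1.ne
    rw [← hk Q h1.le, h, ← RingHom.ker_eq_comap_bot, Ideal.mk_ker]
  have h6 := Ideal.height_add_one_le_of_lt_of_isPrime h4
  have h7 := Ideal.height_add_one_le_of_lt_of_isPrime h5
  have h8 : (1 + 1 : ℕ∞) ≤ 1 :=
    (add_le_add_left (le_trans le_add_self h7) 1).trans (h6.trans h3)
  exact absurd h8 (by decide)

namespace extendedRees

variable {R : Type*} [CommRing R] {𝔞 : Ideal R}

lemma coeff_decompose (f : extendedRees 𝔞) (n : ℤ) :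
    (DirectSum.decompose (grade 𝔞) f n).1.1.coeff n = f.1.coeff n := by
  classical
  conv_rhs => rw [← DirectSum.sum_support_decompose (grade 𝔞) f]
  rw [AddSubmonoidClass.coe_finsetSum, AddMonoidAlgebra.coeff_sum, Finset.sum_apply']
  by_cases hn : n ∈ (DirectSum.decompose (grade 𝔞) f).support
  · rw [Finset.sum_eq_single_of_mem n hn]
    intro m _ hm
    exact (DirectSum.decompose (grade 𝔞) f m).2 n hm.symm
  · rw [DFinsupp.notMem_support_iff.1 hn]
    refine (Finset.sum_eq_zero fun m hm => ?_).symm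
    refine (DirectSum.decompose (grade 𝔞) f m).2 n ?_
    rintro rfl
    exact hn hm

lemma decompose_eq (f : extendedRees 𝔞) (n : ℤ) :
    (DirectSum.decompose (grade 𝔞) f n).1 = monomial n (f.1.coeff n) (f.2 n) := by
  have h := eq_monomial (DirectSum.decompose (grade 𝔞) f n).2
  rw [h]
  congr 1
  exact coeff_decompose f n

lemma mem_of_monomial_mem {J : Ideal (extendedRees 𝔞)} {f : extendedRees 𝔞}
    (h : ∀ n, monomial n (f.1.coeff n) (f.2 n) ∈ J) : f ∈ J := by
  classical
  rw [← DirectSum.sum_support_decompose (grade 𝔞) f]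
  refine sum_mem fun n _ => ?_
  rw [decompose_eq]
  exact h n

lemma monomial_mem {J : Ideal (extendedRees 𝔞)} (hJ : J.IsHomogeneous (grade 𝔞))
    {f : extendedRees 𝔞} (hf : f ∈ J) (n : ℤ) : monomial n (f.1.coeff n) (f.2 n) ∈ J := by
  rw [← decompose_eq]
  exact hJ n hf

lemma le_of_monomial {I J : Ideal (extendedRees 𝔞)} (hI : I.IsHomogeneous (grade 𝔞))
    (h : ∀ n r hr, monomial n r hr ∈ I → monomial n r hr ∈ J) : I ≤ J := fun f hf =>
  mem_of_monomial_mem fun n => h n _ (f.2 n) (monomial_mem hI hf n)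

lemma monomial_mul (i j : ℤ) (r s : R) (hr : r ∈ 𝔞 ^ i.toNat) (hs : s ∈ 𝔞 ^ j.toNat)
    (h : r * s ∈ 𝔞 ^ (i + j).toNat) :
    monomial i r hr * monomial j s hs = monomial (i + j) (r * s) h := by
  refine Subtype.ext ?_
  change C r * T i * (C s * T j) = C (r * s) * T (i + j)
  rw [mul_mul_mul_comm, ← map_mul, ← T_add]

lemma mul_mem_pow {i j : ℤ} {r s : R} (hr : r ∈ 𝔞 ^ i.toNat) (hs : s ∈ 𝔞 ^ j.toNat) :
    r * s ∈ 𝔞 ^ (i + j).toNat := by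
  refine Ideal.pow_le_pow_right (show (i + j).toNat ≤ i.toNat + j.toNat by omega) ?_
  rw [pow_add]
  exact Ideal.mul_mem_mul hr hs

lemma algebraMap_eq_monomial (r : R) :
    algebraMap R (extendedRees 𝔞) r = monomial 0 r (by simp) := by
  refine Subtype.ext ?_
  change C r = C r * T 0
  rw [T_zero, mul_one]

lemma invT_pow_mul_monomial (n : ℕ) (r : R) (h : r ∈ 𝔞 ^ (n : ℤ).toNat) :
    invT 𝔞 ^ n * monomial n r h = algebraMap R _ r := by
  refine Subtype.ext ?_
  change (invT 𝔞 : R[T;T⁻¹]) ^ n * (C r * T n) = C r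
  rw [val_invT, T_pow, T_mul, mul_T_assoc]
  simp

lemma monomial_neg (n : ℕ) (r : R) (h : r ∈ 𝔞 ^ (-(n : ℤ)).toNat) :
    monomial (-n) r h = algebraMap R _ r * invT 𝔞 ^ n := by
  refine Subtype.ext ?_
  change C r * T (-n) = C r * (invT 𝔞 : R[T;T⁻¹]) ^ n
  rw [val_invT, T_pow]
  simp

lemma invT_mem_nonZeroDivisors : invT 𝔞 ∈ nonZeroDivisors (extendedRees 𝔞) := by
  rw [mem_nonZeroDivisors_iff_right]
  intro f hf
  have h := congrArg Subtype.val hf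
  change f.1 * (invT 𝔞 : R[T;T⁻¹]) = 0 at h
  rw [val_invT] at h
  exact Subtype.ext ((isUnit_T (-1)).mul_left_eq_zero.1 h)

lemma invT_mem_grade : invT 𝔞 ∈ grade 𝔞 (-1) := monomial_mem_grade _ _ _

lemma algebraMap_mem_grade (r : R) : algebraMap R (extendedRees 𝔞) r ∈ grade 𝔞 0 := by
  rw [algebraMap_eq_monomial]
  exact monomial_mem_grade _ _ _

/-- The elements all of whose coefficients lie in `p`. -/
noncomputable def coeffIdeal (𝔞 p : Ideal R) : Ideal (extendedRees 𝔞) :=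
  RingHom.ker ((AddMonoidAlgebra.mapRingHom ℤ (Ideal.Quotient.mk p)).comp
    (extendedRees 𝔞).val.toRingHom)

lemma mem_coeffIdeal {p : Ideal R} {f : extendedRees 𝔞} :
    f ∈ coeffIdeal 𝔞 p ↔ ∀ n, f.1.coeff n ∈ p := by
  rw [coeffIdeal, RingHom.mem_ker, LaurentPolynomial.ext_iff]
  refine forall_congr' fun n => ?_
  rw [← Ideal.Quotient.eq_zero_iff_mem]
  rfl

instance (p : Ideal R) [p.IsPrime] : (coeffIdeal 𝔞 p).IsPrime := RingHom.ker_isPrime _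

lemma monomial_mem_coeffIdeal {p : Ideal R} {n : ℤ} {r : R} {hr : r ∈ 𝔞 ^ n.toNat} (h : r ∈ p) :
    monomial n r hr ∈ coeffIdeal 𝔞 p := by
  rw [mem_coeffIdeal]
  intro m
  change (C r * T n : R[T;T⁻¹]).coeff m ∈ p
  rw [coeff_C_mul_T]
  split_ifs
  · exact h
  · exact zero_mem _

lemma algebraMap_mem_coeffIdeal {p : Ideal R} {r : R} (h : r ∈ p) :
    algebraMap R _ r ∈ coeffIdeal 𝔞 p := by
  rw [algebraMap_eq_monomial]
  exact monomial_mem_coeffIdeal h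

lemma coeffIdeal_mono {p q : Ideal R} (h : p ≤ q) : coeffIdeal 𝔞 p ≤ coeffIdeal 𝔞 q := by
  intro f hf
  rw [mem_coeffIdeal] at hf ⊢
  exact fun n => h (hf n)

lemma invT_notMem_coeffIdeal {p : Ideal R} (hp : p ≠ ⊤) : invT 𝔞 ∉ coeffIdeal 𝔞 p := by
  intro h
  rw [mem_coeffIdeal] at h
  have := h (-1)
  rw [val_invT, T_apply, if_pos rfl] at this
  exact hp ((Ideal.eq_top_iff_one _).2 this)

lemma le_coeffIdeal {P : Ideal (extendedRees 𝔞)} [hP : P.IsPrime] (h : P.IsHomogeneous (grade 𝔞))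
    (hu : invT 𝔞 ∉ P) : P ≤ coeffIdeal 𝔞 (P.comap (algebraMap R (extendedRees 𝔞))) := by
  refine le_of_monomial h fun n r hr hn => monomial_mem_coeffIdeal ?_
  rw [Ideal.mem_comap]
  obtain ⟨k, rfl | rfl⟩ := Int.eq_nat_or_neg n
  · rw [← invT_pow_mul_monomial k r hr]
    exact Ideal.mul_mem_left _ _ hn
  · rw [monomial_neg] at hn
    exact (hP.mem_or_mem hn).resolve_right fun h => hu (hP.mem_of_pow_mem _ h)

lemma grade_le_of_monomial_one_mem {P : Ideal (extendedRees 𝔞)}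
    (h : ∀ a ha, monomial 1 a ha ∈ P) {n : ℤ} (hn : 0 < n) {f : extendedRees 𝔞}
    (hf : f ∈ grade 𝔞 n) : f ∈ P := by
  rw [eq_monomial hf]
  suffices ∀ r hr, monomial n r hr ∈ P from this _ _
  intro r hr
  clear hf
  obtain ⟨k, rfl⟩ : ∃ k : ℕ, n = k + 1 := ⟨(n - 1).toNat, by omega⟩
  have hk : 𝔞 ^ ((k : ℤ) + 1).toNat = 𝔞 ^ k * 𝔞 := by rw [← pow_succ]; rfl
  have hr' := hr
  rw [hk] at hr'
  suffices h' : ∃ hr, monomial ((k : ℤ) + 1) r hr ∈ P from h'.2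
  refine Submodule.mul_induction_on hr' (fun a ha b hb => ?_) (fun a b ha hb => ?_)
  · have h1 : a ∈ 𝔞 ^ (k : ℤ).toNat := by simpa using ha
    have h2 : b ∈ 𝔞 ^ (1 : ℤ).toNat := by simpa using hb
    refine ⟨mul_mem_pow h1 h2, ?_⟩
    have := monomial_mul _ _ a b h1 h2 (mul_mem_pow h1 h2)
    exact this ▸ Ideal.mul_mem_left _ _ (h b h2)
  · obtain ⟨h1, h2⟩ := ha
    obtain ⟨h3, h4⟩ := hb
    refine ⟨add_mem h1 h3, ?_⟩
    convert add_mem h2 h4 using 1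
    refine Subtype.ext ?_
    change C (a + b) * T _ = C a * T _ + C b * T _
    rw [map_add, add_mul]

end extendedRees

namespace extendedRees

variable {R : Type*} [CommRing R] {𝔞 : Ideal R}

/-- For a prime `p ⊇ 𝔞`, the ideal of elements whose constant coefficient lies in `p`. -/
def homMax (p : Ideal R) (h : 𝔞 ≤ p) : Ideal (extendedRees 𝔞) where
  carrier := {f | f.1.coeff 0 ∈ p}
  add_mem' hf hg := p.add_mem hf hg
  zero_mem' := zero_mem p
  smul_mem' c f hf := by
    change (c.1 * f.1).coeff 0 ∈ p
    rw [AddMonoidAlgebra.coeff_mul]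
    refine Submodule.sum_mem _ fun i _ => Submodule.sum_mem _ fun j _ => ?_
    dsimp only
    split_ifs with hij
    · rcases lt_trichotomy j 0 with hj | rfl | hj
      · refine Ideal.mul_mem_right _ _ (h (Ideal.pow_le_self (n := i.toNat) ?_ (c.2 i)))
        omega
      · exact Ideal.mul_mem_left _ _ hf
      · refine Ideal.mul_mem_left _ _ (h (Ideal.pow_le_self (n := j.toNat) ?_ (f.2 j)))
        omega
    · exact zero_mem _

lemma mem_homMax {p : Ideal R} {h : 𝔞 ≤ p} {f : extendedRees 𝔞} :
    f ∈ homMax p h ↔ f.1.coeff 0 ∈ p := Iff.rfl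

lemma monomial_mem_homMax {p : Ideal R} {h : 𝔞 ≤ p} {n : ℤ} {r : R} {hr : r ∈ 𝔞 ^ n.toNat} :
    monomial n r hr ∈ homMax p h ↔ (n = 0 → r ∈ p) := by
  rw [mem_homMax]
  change (C r * T n : R[T;T⁻¹]).coeff 0 ∈ p ↔ _
  rw [coeff_C_mul_T]
  split_ifs with hn <;> simp [hn]

lemma algebraMap_mem_homMax {p : Ideal R} {h : 𝔞 ≤ p} {r : R} :
    algebraMap R (extendedRees 𝔞) r ∈ homMax p h ↔ r ∈ p := by
  rw [algebraMap_eq_monomial, monomial_mem_homMax]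
  simp

lemma isHomogeneous_homMax {p : Ideal R} {h : 𝔞 ≤ p} :
    (homMax p h).IsHomogeneous (grade 𝔞) := by
  intro n f hf
  rw [decompose_eq, monomial_mem_homMax]
  rintro rfl
  exact hf

lemma sub_algebraMap_mem_homMax {p : Ideal R} {h : 𝔞 ≤ p} (f : extendedRees 𝔞) :
    f - algebraMap R _ (f.1.coeff 0) ∈ homMax p h := by
  rw [mem_homMax]
  change f.1.coeff 0 - (C (f.1.coeff 0) : R[T;T⁻¹]).coeff 0 ∈ p
  simp

instance {p : Ideal R} [hp : p.IsPrime] {h : 𝔞 ≤ p} : (homMax p h).IsPrime where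
  ne_top' hM := hp.ne_top ((Ideal.eq_top_iff_one _).2 (by
    rw [← algebraMap_mem_homMax (h := h), hM]; trivial))
  mem_or_mem' {f g} hfg := by
    have h1 : algebraMap R (extendedRees 𝔞) (f.1.coeff 0 * g.1.coeff 0) ∈ homMax p h := by
      have h2 := Ideal.mul_mem_left _ f (sub_algebraMap_mem_homMax (h := h) g)
      have h3 := Ideal.mul_mem_left _ (algebraMap R _ (g.1.coeff 0))
        (sub_algebraMap_mem_homMax (h := h) f)
      have h4 := sub_mem (sub_mem hfg h2) h3
      convert h4 using 1
      rw [map_mul]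
      ring
    rw [algebraMap_mem_homMax] at h1
    exact hp.mem_or_mem h1

lemma invT_mem_homMax {p : Ideal R} {h : 𝔞 ≤ p} : invT 𝔞 ∈ homMax p h :=
  monomial_mem_homMax.2 fun h => absurd h (by decide)

/-- An ideal contains `homMax p` once it contains `p`, `𝔞 t` and `t⁻¹`. -/
lemma homMax_le {p : Ideal R} {h : 𝔞 ≤ p} {J : Ideal (extendedRees 𝔞)}
    (h0 : p ≤ J.comap (algebraMap R (extendedRees 𝔞))) (h1 : ∀ a ha, monomial 1 a ha ∈ J)
    (h2 : invT 𝔞 ∈ J) : homMax p h ≤ J := by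
  refine le_of_monomial isHomogeneous_homMax fun n r hr hn => ?_
  rcases lt_trichotomy n 0 with hn0 | rfl | hn0
  · obtain ⟨k, rfl⟩ : ∃ k : ℕ, n = -((k + 1 : ℕ) : ℤ) := ⟨(-n - 1).toNat, by omega⟩
    rw [monomial_neg, pow_succ]
    exact Ideal.mul_mem_left _ _ (Ideal.mul_mem_left _ _ h2)
  · have := h0 (monomial_mem_homMax.1 hn rfl)
    rwa [Ideal.mem_comap, algebraMap_eq_monomial] at this
  · exact grade_le_of_monomial_one_mem h1 hn0 (monomial_mem_grade _ _ _)

lemma homMax_eq_span {p : Ideal R} (h : 𝔞 ≤ p) : homMax p h = Ideal.span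
      ({y : extendedRees 𝔞 | ∃ x ∈ p, (y : R[T;T⁻¹]) = C x} ∪
        {y : extendedRees 𝔞 | ∃ a ∈ 𝔞, (y : R[T;T⁻¹]) = C a * T 1} ∪
        {y : extendedRees 𝔞 | (y : R[T;T⁻¹]) = T (-1)}) := by
  apply le_antisymm
  · apply homMax_le
    · exact fun x hx => Ideal.subset_span (Or.inl (Or.inl ⟨x, hx, rfl⟩))
    · exact fun a ha => Ideal.subset_span (Or.inl (Or.inr ⟨a, by simpa using ha, rfl⟩))
    · exact Ideal.subset_span (Or.inr val_invT)
  · rw [Ideal.span_le]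
    rintro y ((⟨x, hx, hy⟩ | ⟨a, ha, hy⟩) | hy)
    · rw [show y = algebraMap R _ x from Subtype.ext hy]
      exact algebraMap_mem_homMax.2 hx
    · rw [show y = monomial 1 a (by simpa using ha) from Subtype.ext hy]
      exact monomial_mem_homMax.2 (by simp)
    · rw [show y = invT 𝔞 from Subtype.ext (hy.trans val_invT.symm)]
      exact invT_mem_homMax

lemma le_homMax [IsLocalRing R] {h : 𝔞 ≤ maximalIdeal R} {P : Ideal (extendedRees 𝔞)}
    (hP : P.IsHomogeneous (grade 𝔞)) (hP' : P ≠ ⊤) : P ≤ homMax (maximalIdeal R) h := by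
  refine le_of_monomial hP fun n r hr hn => ?_
  rw [monomial_mem_homMax]
  rintro rfl
  rw [mem_maximalIdeal, mem_nonunits_iff]
  intro hu
  rw [← algebraMap_eq_monomial] at hn
  exact hP' (Ideal.eq_top_of_isUnit_mem _ hn (hu.map _))

lemma coeffIdeal_lt_homMax {p : Ideal R} [hp : p.IsPrime] (h : 𝔞 ≤ p) :
    coeffIdeal 𝔞 p < homMax p h :=
  SetLike.lt_iff_le_and_exists.2 ⟨fun _ hf => mem_homMax.2 (mem_coeffIdeal.1 hf 0),
    invT 𝔞, invT_mem_homMax, invT_notMem_coeffIdeal hp.ne_top⟩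

end extendedRees

lemma Ideal.mem_minimalPrimes_of_le_of_le {B : Type*} [CommRing B] {I K P : Ideal B}
    (h : P ∈ I.minimalPrimes) (h1 : I ≤ K) (h2 : K ≤ P) : P ∈ K.minimalPrimes :=
  ⟨⟨h.1.1, h2⟩, fun _ hQ hQP => h.2 ⟨hQ.1, h1.trans hQ.2⟩ hQP⟩

namespace extendedRees

variable {R : Type*} [CommRing R] {𝔞 : Ideal R}

lemma isHomogeneous_coeffIdeal (p : Ideal R) : (coeffIdeal 𝔞 p).IsHomogeneous (grade 𝔞) := by
  intro n f hf
  rw [decompose_eq]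
  exact monomial_mem_coeffIdeal (mem_coeffIdeal.1 hf n)

lemma isHomogeneous_span_invT : (Ideal.span {invT 𝔞}).IsHomogeneous (grade 𝔞) := by
  refine Ideal.homogeneous_span _ _ fun x hx => ?_
  rw [Set.mem_singleton_iff.1 hx]
  exact ⟨-1, invT_mem_grade⟩

/-- A homogeneous ideal lies in a prime containing `𝔞 t` and `t⁻¹` as soon as its degree zero part
does. -/
lemma le_of_algebraMap_mem {K P : Ideal (extendedRees 𝔞)} (hK : K.IsHomogeneous (grade 𝔞))
    (h1 : ∀ a ha, monomial 1 a ha ∈ P) (h2 : invT 𝔞 ∈ P)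
    (h0 : ∀ r : R, algebraMap R _ r ∈ K → algebraMap R _ r ∈ P) : K ≤ P := by
  refine le_of_monomial hK fun n r hr hn => ?_
  rcases lt_trichotomy n 0 with hn0 | rfl | hn0
  · obtain ⟨k, rfl⟩ : ∃ k : ℕ, n = -((k + 1 : ℕ) : ℤ) := ⟨(-n - 1).toNat, by omega⟩
    rw [monomial_neg, pow_succ]
    exact Ideal.mul_mem_left _ _ (Ideal.mul_mem_left _ _ h2)
  · rw [← algebraMap_eq_monomial] at hn ⊢
    exact h0 r hn
  · exact grade_le_of_monomial_one_mem h1 hn0 (monomial_mem_grade _ _ _)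

/-- Homogeneous prime avoidance in positive degrees. -/
lemma exists_mem_grade_forall_notMem (F : Finset (Ideal (extendedRees 𝔞)))
    (hp : ∀ P ∈ F, P.IsPrime) (hh : ∀ P ∈ F, P.IsHomogeneous (grade 𝔞))
    (hT : ∀ P ∈ F, ∃ a ha, monomial 1 a ha ∉ P) (hF : ∀ P ∈ F, ∀ Q ∈ F, P ≤ Q → P = Q) :
    ∃ n : ℕ, 0 < n ∧ ∃ z ∈ grade 𝔞 n, ∀ P ∈ F, z ∉ P := by
  classical
  induction F using Finset.induction_on with
  | empty => exact ⟨1, one_pos, 0, zero_mem _, by simp⟩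
  | insert P F hPF ih =>
    obtain ⟨n, hn, z, hz, hzF⟩ := ih (fun Q hQ => hp Q (Finset.mem_insert_of_mem hQ))
      (fun Q hQ => hh Q (Finset.mem_insert_of_mem hQ))
      (fun Q hQ => hT Q (Finset.mem_insert_of_mem hQ))
      (fun Q hQ Q' hQ' => hF Q (Finset.mem_insert_of_mem hQ) Q' (Finset.mem_insert_of_mem hQ'))
    by_cases hzP : z ∈ P
    swap
    · refine ⟨n, hn, z, hz, fun Q hQ => ?_⟩
      rcases Finset.mem_insert.1 hQ with rfl | hQ
      · exact hzP
      · exact hzF Q hQ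
    have hPp := hp P (Finset.mem_insert_self _ _)
    have hK : ¬ F.inf id ≤ P := by
      rw [hPp.inf_le']
      rintro ⟨Q, hQ, hQP⟩
      have := hF Q (Finset.mem_insert_of_mem hQ) P (Finset.mem_insert_self _ _) hQP
      exact hPF (this ▸ hQ)
    have hKh : (F.inf id).IsHomogeneous (grade 𝔞) := by
      rw [Finset.inf_eq_iInf]
      exact Ideal.IsHomogeneous.iInf₂ fun Q hQ => hh Q (Finset.mem_insert_of_mem hQ)
    obtain ⟨k, r, hr, hrK, hrP⟩ : ∃ k r hr, monomial (𝔞 := 𝔞) k r hr ∈ F.inf id ∧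
        monomial k r hr ∉ P := by
      by_contra! h
      exact hK (le_of_monomial hKh h)
    obtain ⟨a, ha, haP⟩ := hT P (Finset.mem_insert_self _ _)
    obtain ⟨m, N, hm, hmk⟩ : ∃ m N : ℕ, 0 < m ∧ (m : ℤ) = k + N • (1 : ℤ) :=
      ⟨(k + (k.natAbs + 1 : ℕ)).toNat, k.natAbs + 1, by omega,
        by rw [nsmul_eq_mul, mul_one]; omega⟩
    have hw : monomial k r hr * monomial 1 a ha ^ N ∈ grade 𝔞 m := by
      rw [hmk]
      exact SetLike.mul_mem_graded (monomial_mem_grade _ _ _)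
        (SetLike.pow_mem_graded _ (monomial_mem_grade _ _ _))
    have hwP : monomial k r hr * monomial 1 a ha ^ N ∉ P := fun h =>
      (hPp.mem_or_mem h).elim hrP fun h => haP (hPp.mem_of_pow_mem _ h)
    have hwF : ∀ Q ∈ F, monomial k r hr * monomial 1 a ha ^ N ∈ Q := fun Q hQ =>
      Ideal.mul_mem_right _ _ ((Finset.inf_le hQ : F.inf id ≤ Q) hrK)
    generalize monomial k r hr * monomial 1 a ha ^ N = w at hw hwP hwF
    refine ⟨m * n, Nat.mul_pos hm hn, z ^ m + w ^ n, ?_, fun Q hQ => ?_⟩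
    · refine add_mem ?_ ?_
      · simpa using SetLike.pow_mem_graded m hz
      · simpa [mul_comm] using SetLike.pow_mem_graded n hw
    · rcases Finset.mem_insert.1 hQ with rfl | hQ
      · rw [Ideal.add_mem_iff_right _ (Ideal.pow_mem_of_mem _ hzP _ hm)]
        exact fun h => hwP (hPp.mem_of_pow_mem _ h)
      · rw [Ideal.add_mem_iff_left _ (Ideal.pow_mem_of_mem _ (hwF Q hQ) _ hn)]
        exact fun h => hzF Q hQ ((hp Q (Finset.mem_insert_of_mem hQ)).mem_of_pow_mem _ h)

section IsLocalRing

variable [IsNoetherianRing (extendedRees 𝔞)] [IsLocalRing R] (h : 𝔞 ≤ maximalIdeal R)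
  {I : Ideal (extendedRees 𝔞)}

lemma exists_mem_maximalIdeal_forall (hI : I.IsHomogeneous (grade 𝔞)) :
    ∃ b ∈ maximalIdeal R,
      (∀ P ∈ I.minimalPrimes, (∃ a ha, monomial 1 a ha ∉ P) → algebraMap R _ b ∈ P) ∧
      ∀ P ∈ (I ⊔ Ideal.span {invT 𝔞}).minimalPrimes, P ≠ homMax (maximalIdeal R) h →
        (∀ a ha, monomial 1 a ha ∈ P) → algebraMap R _ b ∉ P := by
  classical
  have hZ : {P ∈ I.minimalPrimes | ∃ a ha, monomial 1 a ha ∉ P}.Finite :=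
    (Ideal.finite_minimalPrimes_of_isNoetherianRing _ I).subset fun _ h => h.1
  have hα : {P ∈ (I ⊔ Ideal.span {invT 𝔞}).minimalPrimes | P ≠ homMax (maximalIdeal R) h ∧
      ∀ a ha, monomial 1 a ha ∈ P}.Finite :=
    (Ideal.finite_minimalPrimes_of_isNoetherianRing _ _).subset fun _ h => h.1
  by_contra! hcon
  have hsub : ((maximalIdeal R ⊓ hZ.toFinset.inf
      fun P => P.comap (algebraMap R (extendedRees 𝔞)) : Ideal R) : Set R) ⊆
      ⋃ P ∈ {P ∈ (I ⊔ Ideal.span {invT 𝔞}).minimalPrimes | P ≠ homMax (maximalIdeal R) h ∧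
      ∀ a ha, monomial 1 a ha ∈ P}, (P.comap (algebraMap R (extendedRees 𝔞)) : Ideal R) := by
    intro b hb
    obtain ⟨P, h1, h2, h3, h4⟩ := hcon b hb.1 fun P hP hPT =>
      (Finset.inf_le (hZ.mem_toFinset.2 ⟨hP, hPT⟩) :
        (hZ.toFinset.inf fun P => P.comap (algebraMap R (extendedRees 𝔞))) ≤ _) hb.2
    exact Set.mem_biUnion (show P ∈ _ from ⟨h1, h2, h3⟩) h4
  obtain ⟨P', ⟨hP', hPM, hPT⟩, hle⟩ := (Ideal.subset_union_prime_finite hα ⊥ ⊥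
    fun P hP _ _ => have := hP.1.1.1; Ideal.IsPrime.comap _).1 hsub
  have hPp := hP'.1.1
  have hIP : I ≤ P' := le_sup_left.trans hP'.1.2
  have hPh := Ideal.IsHomogeneous.of_mem_minimalPrimes (hI.sup isHomogeneous_span_invT) hP'
  have huP : invT 𝔞 ∈ P' :=
    hP'.1.2 ((le_sup_right : _ ≤ I ⊔ Ideal.span {invT 𝔞}) (Ideal.mem_span_singleton_self _))
  have hc : (P'.comap (algebraMap R (extendedRees 𝔞))).IsPrime := Ideal.IsPrime.comap _
  rcases hc.inf_le.1 hle with hm | hm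
  · exact hPM (le_antisymm (le_homMax hPh hPp.ne_top) (homMax_le hm hPT huP))
  · obtain ⟨P, hPZ, hPP⟩ := hc.inf_le'.1 hm
    obtain ⟨hPI, a, ha, haP⟩ := hZ.mem_toFinset.1 hPZ
    have hp := hPI.1.1
    have hh := Ideal.IsHomogeneous.of_mem_minimalPrimes hI hPI
    have hPle : P ≤ P' := le_of_algebraMap_mem hh hPT huP fun r hr => hPP hr
    by_cases hu : invT 𝔞 ∈ P
    · have hle : P' ≤ P := hP'.2 ⟨hp, sup_le hPI.1.2
        ((Ideal.span_singleton_le_iff_mem _).2 hu)⟩ hPle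
      exact haP (hle (hPT a ha))
    · have hmin : P' ∈ (P ⊔ Ideal.span {invT 𝔞}).minimalPrimes :=
        Ideal.mem_minimalPrimes_of_le_of_le hP' (sup_le_sup_right hPI.1.2 _)
          (sup_le hPle ((Ideal.span_singleton_le_iff_mem _).2 huP))
      refine Ideal.not_lt_of_mem_minimalPrimes_sup_span hmin
        (Q := coeffIdeal 𝔞 (P'.comap (algebraMap R (extendedRees 𝔞)))) ?_ ?_
      · refine SetLike.lt_iff_le_and_exists.2 ⟨(le_coeffIdeal hh hu).trans (coeffIdeal_mono hPP),
          _, ?_, haP⟩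
        refine monomial_mem_coeffIdeal ?_
        rw [Ideal.mem_comap, ← invT_pow_mul_monomial 1 a ha]
        exact Ideal.mul_mem_left _ _ (hPT a ha)
      · refine SetLike.lt_iff_le_and_exists.2 ⟨?_, invT 𝔞, huP,
          invT_notMem_coeffIdeal hc.ne_top⟩
        refine le_of_algebraMap_mem (isHomogeneous_coeffIdeal _) hPT huP fun r hr => ?_
        have := mem_coeffIdeal.1 hr 0
        rw [algebraMap_eq_monomial] at this
        change (C r * T 0 : R[T;T⁻¹]).coeff 0 ∈ _ at this
        rwa [coeff_C_mul_T, if_pos rfl] at this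

/-- The inductive step in the construction of a homogeneous system of parameters modulo `t⁻¹`. -/
lemma exists_cons (hI : I.IsHomogeneous (grade 𝔞)) {i : ℕ}
    (hIJ : I ≤ coeffIdeal 𝔞 (maximalIdeal R)) {ys : List (extendedRees 𝔞)}
    (hys : (Ideal.ofList ys).radical = I.radical)
    (hht : ∀ P ∈ (I ⊔ Ideal.span {invT 𝔞}).minimalPrimes, P ≠ homMax (maximalIdeal R) h →
      (i + 1 : ℕ) ≤ P.height) :
    ∃ (I' : Ideal (extendedRees 𝔞)) (y : extendedRees 𝔞), I'.IsHomogeneous (grade 𝔞) ∧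
      I' ≤ coeffIdeal 𝔞 (maximalIdeal R) ∧ y ∈ coeffIdeal 𝔞 (maximalIdeal R) ∧
      (Ideal.ofList (y :: ys)).radical = I'.radical ∧
      ∀ P ∈ (I' ⊔ Ideal.span {invT 𝔞}).minimalPrimes, P ≠ homMax (maximalIdeal R) h →
        (i + 1 + 1 : ℕ) ≤ P.height := by
  classical
  obtain ⟨b, hb, hbZ, hbα⟩ := exists_mem_maximalIdeal_forall h hI
  have hβ : {P ∈ (I ⊔ Ideal.span {invT 𝔞}).minimalPrimes | P ≠ homMax (maximalIdeal R) h ∧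
      ∃ a ha, monomial 1 a ha ∉ P}.Finite :=
    (Ideal.finite_minimalPrimes_of_isNoetherianRing _ _).subset fun _ h => h.1
  have hIu : (I ⊔ Ideal.span {invT 𝔞}).IsHomogeneous (grade 𝔞) := hI.sup isHomogeneous_span_invT
  obtain ⟨n, hn, z, hz, hzβ⟩ := exists_mem_grade_forall_notMem hβ.toFinset
    (fun P hP => (hβ.mem_toFinset.1 hP).1.1.1)
    (fun P hP => .of_mem_minimalPrimes hIu (hβ.mem_toFinset.1 hP).1)
    (fun P hP => (hβ.mem_toFinset.1 hP).2.2)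
    (fun P hP Q hQ hPQ => le_antisymm hPQ
      ((hβ.mem_toFinset.1 hQ).1.2 (hβ.mem_toFinset.1 hP).1.1 hPQ))
  have hbJ : algebraMap R _ b ∈ coeffIdeal 𝔞 (maximalIdeal R) := algebraMap_mem_coeffIdeal hb
  have hzJ : z ∈ coeffIdeal 𝔞 (maximalIdeal R) := by
    rw [eq_monomial hz]
    refine monomial_mem_coeffIdeal (h (Ideal.pow_le_self ?_ (z.2 n)))
    omega
  have hbz : ∀ P : Ideal (extendedRees 𝔞), P.IsPrime → I ≤ P → algebraMap R _ b * z ∈ P := by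
    intro P hP hIP
    obtain ⟨Q, hQ, hQP⟩ := Ideal.exists_minimalPrimes_le hIP
    refine hQP ?_
    by_cases hT : ∃ a ha, monomial 1 a ha ∉ Q
    · exact Ideal.mul_mem_right _ _ (hbZ Q hQ hT)
    · push Not at hT
      exact Ideal.mul_mem_left _ _ (grade_le_of_monomial_one_mem hT (by omega) hz)
  refine ⟨I ⊔ Ideal.span {algebraMap R _ b, z}, algebraMap R _ b + z, ?_, ?_, add_mem hbJ hzJ,
    ?_, ?_⟩
  · refine hI.sup (Ideal.homogeneous_span _ _ ?_)
    rintro x (rfl | rfl)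
    · exact ⟨0, algebraMap_mem_grade b⟩
    · exact ⟨n, hz⟩
  · refine sup_le hIJ (Ideal.span_le.2 ?_)
    rintro x (rfl | rfl)
    · exact hbJ
    · exact hzJ
  · have hkey : ∀ P : Ideal (extendedRees 𝔞), P.IsPrime →
        (Ideal.ofList ((algebraMap R _ b + z) :: ys) ≤ P ↔
          I ⊔ Ideal.span {algebraMap R _ b, z} ≤ P) := by
      intro P hP
      have h1 : Ideal.ofList ys ≤ P ↔ I ≤ P := by
        rw [← hP.radical_le_iff, hys, hP.radical_le_iff]
      rw [Ideal.ofList_cons, sup_le_iff, sup_le_iff, h1, and_comm,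
        Ideal.span_singleton_le_iff_mem, Ideal.span_le, Set.insert_subset_iff,
        Set.singleton_subset_iff]
      refine and_congr_right fun hIP => ⟨fun hy => ?_, fun hy => add_mem hy.1 hy.2⟩
      rcases hP.mem_or_mem (hbz P hP hIP) with h2 | h2
      · exact ⟨h2, (Ideal.add_mem_iff_right _ h2).1 hy⟩
      · exact ⟨(Ideal.add_mem_iff_left _ h2).1 hy, h2⟩
    rw [Ideal.radical_eq_sInf, Ideal.radical_eq_sInf]
    congr 1
    ext P
    exact ⟨fun h => ⟨(hkey P h.2).1 h.1, h.2⟩, fun h => ⟨(hkey P h.2).2 h.1, h.2⟩⟩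
  · intro P hP hPM
    have hPp := hP.1.1
    obtain ⟨hI', hu⟩ := sup_le_iff.1 hP.1.2
    obtain ⟨hIP, hbzP⟩ := sup_le_iff.1 hI'
    rw [Ideal.span_le, Set.insert_subset_iff, Set.singleton_subset_iff] at hbzP
    obtain ⟨Q, hQ, hQP⟩ := Ideal.exists_minimalPrimes_le (sup_le hIP hu)
    have hQp := hQ.1.1
    have hI'h : (I ⊔ Ideal.span {algebraMap R _ b, z} ⊔
        Ideal.span {invT 𝔞}).IsHomogeneous (grade 𝔞) := by
      refine (hI.sup (Ideal.homogeneous_span _ _ ?_)).sup isHomogeneous_span_invT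
      rintro x (rfl | rfl)
      · exact ⟨0, algebraMap_mem_grade b⟩
      · exact ⟨n, hz⟩
    have hQM : Q ≠ homMax (maximalIdeal R) h := by
      rintro rfl
      exact hPM (le_antisymm
        (le_homMax (.of_mem_minimalPrimes hI'h hP) hPp.ne_top) hQP)
    have hlt : Q < P := by
      refine lt_of_le_of_ne hQP ?_
      rintro rfl
      by_cases hT : ∃ a ha, monomial 1 a ha ∉ Q
      · exact hzβ Q (hβ.mem_toFinset.2 ⟨hQ, hQM, hT⟩) hbzP.2
      · push Not at hT
        exact hbα Q hQ hQM hT hbzP.1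
    refine le_trans ?_ (Ideal.height_add_one_le_of_lt_of_isPrime hlt)
    have := hht Q hQ hQM
    push_cast at this ⊢
    gcongr

end IsLocalRing

end extendedRees

lemma Ideal.radical_eq_radical_of_forall_isPrime {B : Type*} [CommRing B] {I J : Ideal B}
    (h : ∀ P : Ideal B, P.IsPrime → (I ≤ P ↔ J ≤ P)) : I.radical = J.radical := by
  rw [Ideal.radical_eq_sInf, Ideal.radical_eq_sInf]
  congr 1
  ext P
  exact ⟨fun hP => ⟨(h P hP.2).1 hP.1, hP.2⟩, fun hP => ⟨(h P hP.2).2 hP.1, hP.2⟩⟩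

namespace extendedRees

variable {R : Type*} [CommRing R] {𝔞 : Ideal R}

lemma val_mem_map_of_mem_coeffIdeal {p : Ideal R} {f : extendedRees 𝔞} (hf : f ∈ coeffIdeal 𝔞 p) :
    f.1 ∈ p.map (algebraMap R R[T;T⁻¹]) := by
  rw [sum_coeff_C_mul_T f.1]
  exact sum_mem fun n _ => Ideal.mul_mem_right _ _
    (Ideal.mem_map_of_mem (algebraMap R R[T;T⁻¹]) (mem_coeffIdeal.1 hf n))

variable [IsNoetherianRing (extendedRees 𝔞)] [IsLocalRing R] (h : 𝔞 ≤ maximalIdeal R)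

lemma exists_list_of_length (i : ℕ) :
    ∃ (I : Ideal (extendedRees 𝔞)) (ys : List (extendedRees 𝔞)), ys.length = i ∧
      I.IsHomogeneous (grade 𝔞) ∧ I ≤ coeffIdeal 𝔞 (maximalIdeal R) ∧
      (∀ y ∈ ys, y ∈ coeffIdeal 𝔞 (maximalIdeal R)) ∧ (Ideal.ofList ys).radical = I.radical ∧
      ∀ P ∈ (I ⊔ Ideal.span {invT 𝔞}).minimalPrimes, P ≠ homMax (maximalIdeal R) h →
        (i + 1 : ℕ) ≤ P.height := by
  induction i with
  | zero =>
    refine ⟨⊥, [], rfl, Ideal.IsHomogeneous.bot _, bot_le, by simp, by simp, fun P hP _ => ?_⟩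
    rw [bot_sup_eq] at hP
    simpa using (Ideal.one_le_height_span_singleton_of_mem_nonZeroDivisors
      invT_mem_nonZeroDivisors).trans (Ideal.height_mono hP.1.2)
  | succ i ih =>
    obtain ⟨I, ys, hi, hI, hIJ, hy, hr, hht⟩ := ih
    obtain ⟨I', y, hI', hIJ', hy', hr', hht'⟩ := exists_cons h hI hIJ hr hht
    refine ⟨I', y :: ys, by simp [hi], hI', hIJ', ?_, hr', hht'⟩
    rintro x (_ | ⟨_, hx⟩)
    · exact hy'
    · exact hy x hx

/-- If `extendedRees 𝔞` has dimension at most `d + 1`, then there are `d` elements which generate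
`𝔪 R[t, t⁻¹]` up to radical and which together with `t⁻¹` generate the maximal homogeneous ideal up
to radical. -/
theorem exists_parameters {d : ℕ} (hd : ringKrullDim (extendedRees 𝔞) ≤ (d + 1 : ℕ)) :
    ∃ ys : List (extendedRees 𝔞), ys.length = d ∧
      (Ideal.ofList (invT 𝔞 :: ys)).radical = (homMax (maximalIdeal R) h).radical ∧
      (Ideal.ofList (ys.map (extendedRees 𝔞).val)).radical =
        ((maximalIdeal R).map (algebraMap R R[T;T⁻¹])).radical := by
  obtain ⟨I, ys, hi, hI, hIJ, hy, hr, hht⟩ := exists_list_of_length h d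
  have hI' : ∀ P : Ideal (extendedRees 𝔞), P.IsPrime → (Ideal.ofList ys ≤ P ↔ I ≤ P) := by
    intro P hP
    rw [← hP.radical_le_iff, hr, hP.radical_le_iff]
  have hIM : I ⊔ Ideal.span {invT 𝔞} ≤ homMax (maximalIdeal R) h :=
    sup_le (hIJ.trans (coeffIdeal_lt_homMax h).le)
      ((Ideal.span_singleton_le_iff_mem _).2 invT_mem_homMax)
  have hM : ∀ N : Ideal (extendedRees 𝔞), N.IsPrime → I ⊔ Ideal.span {invT 𝔞} ≤ N →
      homMax (maximalIdeal R) h ≤ N := by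
    intro N hN hle
    obtain ⟨P, hP, hPN⟩ := Ideal.exists_minimalPrimes_le hle
    have hPp := hP.1.1
    suffices P = homMax (maximalIdeal R) h from this ▸ hPN
    by_contra hne
    have hlt := lt_of_le_of_ne (le_homMax (h := h)
      (.of_mem_minimalPrimes (hI.sup isHomogeneous_span_invT) hP) hPp.ne_top) hne
    have h1 := Ideal.height_add_one_le_of_lt_of_isPrime hlt
    have h2 : (homMax (maximalIdeal R) h).height ≤ (d + 1 : ℕ) := by
      have := (Ideal.height_le_ringKrullDim_of_isPrime (I := homMax (maximalIdeal R) h)).trans hd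
      exact_mod_cast this
    have h3 : ((d + 1 : ℕ) : ℕ∞) + 1 ≤ (d + 1 : ℕ) :=
      (add_le_add_left (hht P hP hne) 1).trans (h1.trans h2)
    norm_cast at h3
    omega
  refine ⟨ys, hi, Ideal.radical_eq_radical_of_forall_isPrime fun P hP => ?_,
    Ideal.radical_eq_radical_of_forall_isPrime fun Q hQ => ⟨fun hle => ?_, fun hle => ?_⟩⟩
  · rw [Ideal.ofList_cons, sup_comm, sup_le_iff, hI' P hP, ← sup_le_iff]
    exact ⟨hM P hP, hIM.trans⟩
  · have hPp : (Q.comap (extendedRees 𝔞).val).IsPrime := Ideal.IsPrime.comap _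
    have hIP : I ≤ Q.comap (extendedRees 𝔞).val := by
      rw [← hI' _ hPp, Ideal.ofList, Ideal.span_le]
      intro y hy
      exact hle (Ideal.subset_span (List.mem_map_of_mem hy))
    obtain ⟨P, hP, hPQ⟩ := Ideal.exists_minimalPrimes_le hIP
    have hP1 := hP.1.1
    have hu : invT 𝔞 ∉ P := by
      intro hu
      have : (invT 𝔞 : R[T;T⁻¹]) ∈ Q := hPQ hu
      rw [val_invT] at this
      exact hQ.ne_top (Ideal.eq_top_of_isUnit_mem _ this (isUnit_T _))
    have hPh := Ideal.IsHomogeneous.of_mem_minimalPrimes hI hP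
    have hPJ : P ≤ coeffIdeal 𝔞 (maximalIdeal R) := (le_coeffIdeal hPh hu).trans
      (coeffIdeal_mono (le_maximalIdeal (Ideal.IsPrime.comap _).ne_top))
    have hMmin : homMax (maximalIdeal R) h ∈ (P ⊔ Ideal.span {invT 𝔞}).minimalPrimes :=
      ⟨⟨inferInstance, sup_le (hPJ.trans (coeffIdeal_lt_homMax h).le)
        (le_sup_right.trans hIM)⟩,
        fun N hN _ => hM N hN.1 ((sup_le_sup_right hP.1.2 _).trans hN.2)⟩
    rw [Ideal.map_le_iff_le_comap]
    have hPeq : P = coeffIdeal 𝔞 (maximalIdeal R) := by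
      by_contra hne
      exact Ideal.not_lt_of_mem_minimalPrimes_sup_span hMmin (lt_of_le_of_ne hPJ hne)
        (coeffIdeal_lt_homMax h)
    intro r hr
    have : algebraMap R (extendedRees 𝔞) r ∈ P := by
      rw [hPeq]
      exact algebraMap_mem_coeffIdeal hr
    exact hPQ this
  · rw [Ideal.ofList, Ideal.span_le]
    intro y hy'
    obtain ⟨x, hx, rfl⟩ := List.mem_map.1 hy'
    exact hle (val_mem_map_of_mem_coeffIdeal (hy x hx))

end extendedRees

/-- A `d`-dimensional Noetherian local ring has a system of parameters. -/
lemma IsLocalRing.exists_list_radical_eq {R : Type*} [CommRing R] [IsNoetherianRing R]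
    [IsLocalRing R] {d : ℕ} (hd : ringKrullDim R = d) :
    ∃ xs : List R, xs.length = d ∧ (Ideal.ofList xs).radical = (maximalIdeal R).radical := by
  obtain ⟨s, hs, hc⟩ := Ideal.exists_finset_card_eq_height_of_isNoetherianRing (maximalIdeal R)
  refine ⟨s.toList, ?_, Ideal.radical_eq_radical_of_forall_isPrime fun P hP => ?_⟩
  · rw [Finset.length_toList]
    rw [← maximalIdeal_height_eq_ringKrullDim, ← hc] at hd
    exact_mod_cast hd
  · have h : Ideal.ofList s.toList = Ideal.span s := by
      simp [Ideal.ofList]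
    rw [h]
    exact ⟨fun h => hs.2 ⟨hP, h⟩ (le_maximalIdeal hP.ne_top), hs.1.2.trans⟩

lemma map_mem_powSpan {B B' : Type*} [CommRing B] [CommRing B'] (f : B →+* B') {ys : List B}
    {k : ℕ} {z : B} (hz : z ∈ powSpan ys k) : f z ∈ powSpan (ys.map f) k := by
  suffices powSpan ys k ≤ (powSpan (ys.map f) k).comap f from this hz
  refine Ideal.span_le.2 ?_
  rintro _ ⟨y, hy, rfl⟩
  exact Ideal.subset_span ⟨f y, List.mem_map_of_mem hy, map_pow f y k⟩

/-- If top local cohomology over `R` and `R[t, t⁻¹]` is presented by the same elements, then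
the latter is a quotient of a direct sum of copies of the former. -/
lemma exists_surjective_directSum {R H H' : Type} [CommRing R] [AddCommGroup H] [Module R H]
    [AddCommGroup H'] [Module R[T;T⁻¹] H'] [Module R H'] [IsScalarTower R R[T;T⁻¹] H']
    {xs : List R} {q : ℕ → (R →ₗ[R] H)} (hq : IsTopPresentation xs q)
    {q' : ℕ → (R[T;T⁻¹] →ₗ[R[T;T⁻¹]] H')}
    (hq' : IsTopPresentation (xs.map (algebraMap R R[T;T⁻¹])) q') :
    ∃ f : (DirectSum ℤ fun _ : ℤ => H) →ₗ[R] H', Function.Surjective f := by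
  classical
  have hprod : (xs.map (algebraMap R R[T;T⁻¹])).prod = algebraMap R _ xs.prod :=
    (map_list_prod _ _).symm
  have key : ∀ n : ℤ, ∃ f : H →ₗ[R] H', ∀ m r, f (q m r) = q' m (r • T n) := by
    intro n
    refine exists_linearMap_of_families (xs.prod * ·) q
      (fun m => (q' m).restrictScalars R ∘ₗ LinearMap.toSpanSingleton R R[T;T⁻¹] (T n))
      hq.succ (fun m r => ?_) hq.surj (fun m r hr => ?_)
    · change q' (m + 1) ((xs.prod * r) • T n) = q' m (r • T n)
      rw [← hq'.succ m, hprod, mul_smul, Algebra.smul_def xs.prod]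
    · obtain ⟨l, hl⟩ := hq.ker hr
      change q' m (r • T n) = 0
      rw [← hq'.add m l, hprod]
      refine hq'.zero ?_
      have := Ideal.mul_mem_right (T n) _ (map_mem_powSpan (algebraMap R R[T;T⁻¹]) hl)
      convert this using 1
      rw [Algebra.smul_def, map_mul, map_pow, mul_assoc]
  choose f hf using key
  refine ⟨DirectSum.toModule R ℤ H' f, ?_⟩
  rw [← LinearMap.range_eq_top, eq_top_iff]
  rintro h -
  obtain ⟨m, v, rfl⟩ := hq'.surj h
  rw [sum_coeff_C_mul_T v, map_sum]
  refine sum_mem fun n _ => ⟨DirectSum.lof R ℤ _ n (q m (v.coeff n)), ?_⟩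
  rw [DirectSum.toModule_lof, hf, smul_eq_C_mul]

namespace extendedRees

variable {R : Type} [CommRing R] {𝔞 : Ideal R}

lemma exists_T_mul_mem (a : R[T;T⁻¹]) : ∃ l : ℕ, T (-l) * a ∈ extendedRees 𝔞 := by
  have hT : ∀ l : ℕ, T (-l) ∈ extendedRees 𝔞 := fun l => by
    have := C_mul_T_mem_extendedRees (𝔞 := 𝔞) (n := -l) (r := 1) (by simp)
    simpa using this
  induction a using LaurentPolynomial.induction_on' with
  | add p q hp hq =>
    obtain ⟨l, hl⟩ := hp
    obtain ⟨k, hk⟩ := hq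
    refine ⟨l + k, ?_⟩
    rw [show (T (-((l + k : ℕ) : ℤ)) * (p + q) : R[T;T⁻¹]) =
      T (-k) * (T (-l) * p) + T (-l) * (T (-k) * q) by
        push_cast; rw [neg_add, T_add]; ring]
    exact add_mem (mul_mem (hT k) hl) (mul_mem (hT l) hk)
  | C_mul_T n r =>
    refine ⟨n.natAbs, ?_⟩
    rw [mul_left_comm, ← T_add]
    refine C_mul_T_mem_extendedRees ?_
    rw [show (-(n.natAbs : ℤ) + n).toNat = 0 by omega]
    simp

lemma exists_mem_powSpan {ys : List (extendedRees 𝔞)} {N : ℕ} {a : R[T;T⁻¹]}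
    (ha : a ∈ powSpan (ys.map (extendedRees 𝔞).val) N) :
    ∃ k : ℕ, ∃ w ∈ powSpan ys N, w.1 = T (-k) * a := by
  refine Submodule.span_induction ?_ ?_ ?_ ?_ ha
  · rintro _ ⟨y, hy, rfl⟩
    obtain ⟨x, hx, rfl⟩ := List.mem_map.1 hy
    exact ⟨0, x ^ N, Ideal.subset_span ⟨x, hx, rfl⟩, by simp⟩
  · exact ⟨0, 0, zero_mem _, by simp⟩
  · rintro a b - - ⟨k, w, hw, hk⟩ ⟨k', w', hw', hk'⟩
    refine ⟨k + k', invT 𝔞 ^ k' * w + invT 𝔞 ^ k * w',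
      add_mem (Ideal.mul_mem_left _ _ hw) (Ideal.mul_mem_left _ _ hw'), ?_⟩
    change (invT 𝔞 : R[T;T⁻¹]) ^ k' * w.1 + (invT 𝔞 : R[T;T⁻¹]) ^ k * w'.1 = _
    rw [hk, hk', val_invT, T_pow, T_pow]
    push_cast
    rw [neg_add, T_add, mul_neg_one, mul_neg_one]
    ring
  · rintro c a - ⟨k, w, hw, hk⟩
    obtain ⟨l, hl⟩ := exists_T_mul_mem (𝔞 := 𝔞) c
    refine ⟨l + k, ⟨_, hl⟩ * w, Ideal.mul_mem_left _ _ hw, ?_⟩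
    change T (-l) * c * w.1 = _
    rw [hk]
    push_cast
    rw [neg_add, T_add, smul_eq_mul]
    ring

/-- Top local cohomology over `R[t, t⁻¹]` surjects onto top local cohomology of the extended Rees
algebra, where `t⁻¹` is added to the list of parameters. -/
lemma exists_surjective {H H' : Type} [AddCommGroup H] [Module R[T;T⁻¹] H] [Module R H]
    [IsScalarTower R R[T;T⁻¹] H] [AddCommGroup H'] [Module (extendedRees 𝔞) H'] [Module R H']
    [IsScalarTower R (extendedRees 𝔞) H'] {ys : List (extendedRees 𝔞)}
    {q : ℕ → (R[T;T⁻¹] →ₗ[R[T;T⁻¹]] H)}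
    (hq : IsTopPresentation (ys.map (extendedRees 𝔞).val) q)
    {q' : ℕ → (extendedRees 𝔞 →ₗ[extendedRees 𝔞] H')}
    (hq' : IsTopPresentation (invT 𝔞 :: ys) q') :
    ∃ f : H →ₗ[R] H', Function.Surjective f := by
  have hprod : (ys.map (extendedRees 𝔞).val).prod = ys.prod.1 :=
    (map_list_prod (extendedRees 𝔞).val ys).symm
  have key : ∃ f : H →ₗ[R] H', ∀ (m : ℕ) (v : extendedRees 𝔞),
      f (q m (T (m : ℤ) * v.1)) = q' m v := by
    refine exists_linearMap_of_families (S := R) ((invT 𝔞 :: ys).prod * ·)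
      (fun m => (q m).restrictScalars R ∘ₗ LinearMap.mulLeft R (T (m : ℤ)) ∘ₗ
        (extendedRees 𝔞).val.toLinearMap)
      (fun m => (q' m).restrictScalars R) (fun m v => ?_) hq'.succ (fun h => ?_) (fun m v hv => ?_)
    · change q (m + 1) (T ((m + 1 : ℕ) : ℤ) * ((invT 𝔞 :: ys).prod * v).1) = q m (T (m : ℤ) * v.1)
      rw [← hq.succ m, hprod, List.prod_cons]
      congr 1
      change _ * ((invT 𝔞 : R[T;T⁻¹]) * ys.prod.1 * v.1) = _
      rw [val_invT, mul_assoc, ← mul_assoc, ← T_add, mul_left_comm]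
      push_cast
      rw [add_neg_cancel_right]
    · obtain ⟨m, a, rfl⟩ := hq.surj h
      obtain ⟨l, hl⟩ := exists_T_mul_mem (𝔞 := 𝔞) a
      refine ⟨m + l, ⟨_, hl⟩ * invT 𝔞 ^ m * ys.prod ^ l, ?_⟩
      rw [← hq.add m l, hprod]
      change q (m + l) (T ((m + l : ℕ) : ℤ) *
        (T (-l) * a * (invT 𝔞 : R[T;T⁻¹]) ^ m * ys.prod.1 ^ l)) = _
      congr 1
      rw [val_invT, T_pow, mul_neg_one]
      calc T ((m + l : ℕ) : ℤ) * (T (-l) * a * T (-m) * ys.prod.1 ^ l)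
          = (T ((m + l : ℕ) : ℤ) * T (-l) * T (-m)) * (ys.prod.1 ^ l * a) := by ring
        _ = ys.prod.1 ^ l * a := by
          rw [← T_add, ← T_add]
          push_cast
          rw [show (m + l + -l + -m : ℤ) = 0 by ring, T_zero, one_mul]
    · obtain ⟨l, hl⟩ := hq.ker (show q m (T (m : ℤ) * v.1) = 0 from hv)
      rw [hprod] at hl
      obtain ⟨k, w, hw, hk⟩ := exists_mem_powSpan hl
      have hw' : invT 𝔞 ^ k * (ys.prod ^ l * v) = invT 𝔞 ^ m * w := by
        refine Subtype.ext ?_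
        change (invT 𝔞 : R[T;T⁻¹]) ^ k * (ys.prod.1 ^ l * v.1) = (invT 𝔞 : R[T;T⁻¹]) ^ m * w.1
        rw [hk, val_invT, T_pow, T_pow, mul_neg_one, mul_neg_one]
        calc T (-k) * (ys.prod.1 ^ l * v.1)
            = (T (-m) * T m) * (T (-k) * (ys.prod.1 ^ l * v.1)) := by
              rw [← T_add, neg_add_cancel, T_zero, one_mul]
          _ = _ := by ring
      change q' m v = 0
      rw [← hq'.add m (l + k), List.prod_cons]
      refine hq'.zero ?_
      rw [powSpan_cons]
      refine (le_sup_right : powSpan ys _ ≤ _) ?_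
      rw [show (invT 𝔞 * ys.prod) ^ (l + k) * v =
        invT 𝔞 ^ l * (ys.prod ^ k * (invT 𝔞 ^ k * (ys.prod ^ l * v))) by ring, hw', ← add_assoc]
      exact Ideal.mul_mem_left _ _ (prod_pow_mul_mem_powSpan k (Ideal.mul_mem_left _ _ hw))
  obtain ⟨f, hf⟩ := key
  refine ⟨f, fun h => ?_⟩
  obtain ⟨m, v, rfl⟩ := hq'.surj h
  exact ⟨_, hf m v⟩

lemma exists_surjective_restrictScalars {H₀ H H' : Type} [AddCommGroup H₀] [Module R H₀]
    [AddCommGroup H] [Module R[T;T⁻¹] H] [AddCommGroup H'] [Module (extendedRees 𝔞) H']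
    {xs : List R} {ys : List (extendedRees 𝔞)} {q₀ : ℕ → (R →ₗ[R] H₀)}
    (hq₀ : IsTopPresentation xs q₀) {q₁ q₂ : ℕ → (R[T;T⁻¹] →ₗ[R[T;T⁻¹]] H)}
    (hq₁ : IsTopPresentation (xs.map (algebraMap R R[T;T⁻¹])) q₁)
    (hq₂ : IsTopPresentation (ys.map (extendedRees 𝔞).val) q₂)
    {q₃ : ℕ → (extendedRees 𝔞 →ₗ[extendedRees 𝔞] H')}
    (hq₃ : IsTopPresentation (invT 𝔞 :: ys) q₃) :
    ∃ f : (DirectSum ℤ fun _ : ℤ => H₀) →ₗ[R] RestrictScalars R (extendedRees 𝔞) H',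
      Function.Surjective f := by
  let _ : Module R H := Module.compHom H (algebraMap R R[T;T⁻¹])
  have _ : IsScalarTower R R[T;T⁻¹] H := .of_algebraMap_smul fun _ _ => rfl
  let _ : Module R H' := Module.compHom H' (algebraMap R (extendedRees 𝔞))
  have _ : IsScalarTower R (extendedRees 𝔞) H' := .of_algebraMap_smul fun _ _ => rfl
  obtain ⟨f, hf⟩ := exists_surjective_directSum hq₀ hq₁
  obtain ⟨g, hg⟩ := exists_surjective hq₂ hq₃
  exact ⟨g ∘ₗ f, hg.comp hf⟩

end extendedRees

/-- Let `(R,𝔪)` be a Noetherian local ring of Krull dimension `d ≥ 2` and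
`𝔞 ⊊ R` a proper ideal of positive height (contained in no minimal prime of `R`),
`T𝔞 = R[𝔞t,t⁻¹]` the extended Rees algebra with maximal homogeneous ideal `𝔪_T`.  Then
there is a surjective `R`-linear map `⊕_{i ∈ ℤ} H^d_𝔪(R) ↠ H^{d+1}_{𝔪_T}(T𝔞)`. -/
theorem extendedRees_top_localCohomology_surjection
    {R : Type} [CommRing R] [IsNoetherianRing R] [IsLocalRing R]
    (d : ℕ) (hd2 : 2 ≤ d) (hd : ringKrullDim R = d)
    (𝔞 : Ideal R) (h𝔞 : 𝔞 ≠ ⊤)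
    (hht : ∀ P ∈ minimalPrimes R, ¬ 𝔞 ≤ P)
    (T𝔞 : Subalgebra R (LaurentPolynomial R))
    (hT𝔞 : T𝔞 = Algebra.adjoin R
      ({x : LaurentPolynomial R | ∃ a ∈ 𝔞, C a * T 1 = x} ∪ {T (-1)}))
    (𝔪T : Ideal T𝔞)
    (h𝔪T : 𝔪T = Ideal.span
      ({y : T𝔞 | ∃ x ∈ maximalIdeal R, (y : LaurentPolynomial R) = C x} ∪
        {y : T𝔞 | ∃ a ∈ 𝔞, (y : LaurentPolynomial R) = C a * T 1} ∪
        {y : T𝔞 | (y : LaurentPolynomial R) = T (-1)})) :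
    ∃ f : (DirectSum ℤ fun _ : ℤ =>
        ((localCohomology (maximalIdeal R) d).obj (ModuleCat.of R R))) →ₗ[R]
        (RestrictScalars R T𝔞 ((localCohomology 𝔪T (d + 1)).obj (ModuleCat.of T𝔞 T𝔞))),
      Function.Surjective f := by
  rw [adjoin_eq_extendedRees] at hT𝔞
  subst hT𝔞
  have hle : 𝔞 ≤ maximalIdeal R := le_maximalIdeal h𝔞
  rw [← extendedRees.homMax_eq_span hle] at h𝔪T
  subst h𝔪T
  obtain ⟨hN, hdim⟩ := extendedRees_noetherian_and_dim_le hd.le 𝔞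
  have hNA : IsNoetherianRing R[T;T⁻¹] :=
    IsLocalization.isNoetherianRing (Submonoid.powers (Polynomial.X : Polynomial R)) _ inferInstance
  obtain ⟨xs, hxs, hxr⟩ := exists_list_radical_eq hd
  obtain ⟨ys, hys, hyT, hyA⟩ := extendedRees.exists_parameters hle hdim
  have hxA : (Ideal.ofList (xs.map (algebraMap R R[T;T⁻¹]))).radical =
      ((maximalIdeal R).map (algebraMap R R[T;T⁻¹])).radical := by
    rw [← Ideal.map_ofList]
    refine Ideal.radical_eq_radical_of_forall_isPrime fun P hP => ?_
    have hc : (P.comap (algebraMap R R[T;T⁻¹])).IsPrime := Ideal.IsPrime.comap _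
    rw [Ideal.map_le_iff_le_comap, Ideal.map_le_iff_le_comap, ← hc.radical_le_iff, hxr,
      hc.radical_le_iff]
  obtain ⟨q, hq⟩ := exists_isTopPresentation xs hxr hxs
  obtain ⟨q₁, hq₁⟩ := exists_isTopPresentation _ hxA ((List.length_map _).trans hxs)
  obtain ⟨q₂, hq₂⟩ := exists_isTopPresentation _ hyA ((List.length_map _).trans hys)
  obtain ⟨q₃, hq₃⟩ := exists_isTopPresentation _ hyT (d := d + 1) (by simp [hys])
  exact extendedRees.exists_surjective_restrictScalars hq hq₁ hq₂ hq₃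
end

section
/- Let M be a finitely generated R-module and let N be a submodule of the base-change module A ⊗[R] M that is stable under multiplication by every element of the extended Rees algebra T𝔞 (i.e. a T𝔞-submodule for the action obtained by restricting the A-action). Assume that for every m ∈ M there exists k : ℕ with (T (-k)) ⊗ₜ m ∈ N. Then there exists k₀ : ℕ such that (T (-k)) ⊗ₜ m ∈ N for every k ≥ k₀ and every m ∈ M. (This is the module-theoretic content of the proposition that the graded components [ω_T]_n of the canonical module of the extended Rees algebra coincide with ω_R for all n ≪ 0.) -/
open LaurentPolynomial TensorProduct

/-- Let `R` be a commutative ring, `𝔞 ⊆ R` an ideal,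
`T𝔞 = R[𝔞t,t⁻¹] ⊆ A = R[t,t⁻¹]` the extended Rees algebra, `M` a finitely generated
`R`-module and `N ⊆ A ⊗[R] M` an `R`-submodule stable under multiplication by elements of
`T𝔞`.  If for every `m ∈ M` some `t⁻ᵏ ⊗ m` lies in `N`, then there is `k₀` such that
`t⁻ᵏ ⊗ m ∈ N` for all `k ≥ k₀` and all `m ∈ M`. -/
theorem extendedRees_stable_submodule_uniform_bound
    {R : Type*} [CommRing R] (𝔞 : Ideal R)
    (T𝔞 : Subalgebra R (LaurentPolynomial R))
    (hT𝔞 : T𝔞 = Algebra.adjoin R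
      ({x : LaurentPolynomial R | ∃ a ∈ 𝔞, C a * T 1 = x} ∪ {T (-1)}))
    (M : Type*) [AddCommGroup M] [Module R M] [Module.Finite R M]
    (N : Submodule R (LaurentPolynomial R ⊗[R] M))
    (hstab : ∀ s : LaurentPolynomial R, s ∈ T𝔞 → ∀ x ∈ N, s • x ∈ N)
    (hmem : ∀ m : M, ∃ k : ℕ, (T (-(k : ℤ)) : LaurentPolynomial R) ⊗ₜ[R] m ∈ N) :
    ∃ k₀ : ℕ, ∀ k : ℕ, k₀ ≤ k → ∀ m : M,
      (T (-(k : ℤ)) : LaurentPolynomial R) ⊗ₜ[R] m ∈ N := by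
  have hTneg : T (-1) ∈ T𝔞 := by
    rw [hT𝔞]
    exact Algebra.subset_adjoin (Or.inr rfl)
  have hmono : ∀ (m : M) (j k : ℕ), j ≤ k →
      (T (-(j : ℤ)) : LaurentPolynomial R) ⊗ₜ[R] m ∈ N →
      (T (-(k : ℤ)) : LaurentPolynomial R) ⊗ₜ[R] m ∈ N := by
    intro m j k hjk hj
    induction k, hjk using Nat.le_induction with
    | base => exact hj
    | succ k _ ih =>
      have h := hstab _ hTneg _ ih
      rw [TensorProduct.smul_tmul', smul_eq_mul, ← T_add] at h
      convert h using 3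
      push_cast
      ring
  obtain ⟨S, hS⟩ := Module.Finite.fg_top (R := R) (M := M)
  choose f hf using hmem
  refine ⟨S.sup f, fun k hk m => ?_⟩
  have hle : (⊤ : Submodule R M) ≤
      N.comap (TensorProduct.mk R (LaurentPolynomial R) M (T (-(k : ℤ)))) := by
    rw [← hS, Submodule.span_le]
    exact fun x hx => hmono x (f x) k ((Finset.le_sup hx).trans hk) (hf x)
  exact hle Submodule.mem_top
end

section
/- There is an R-linear isomorphism between T𝔞/S and the free R-module ℕ →₀ R, under which the class of C r * T (-(i+1)) corresponds to r times the i-th standard basis vector; that is, as an R-module, the quotient of the extended Rees algebra by the Rees algebra is the free module ⊕_{i<0} R·t^i on the monomials of negative degree. -/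
set_option synthInstance.maxHeartbeats 1000000
set_option maxHeartbeats 1000000

open LaurentPolynomial

noncomputable section

variable (R : Type*) [CommRing R] (𝔞 : Ideal R)

/-- The Rees algebra `S = R[𝔞t]` inside `A = R[t,t⁻¹]`. -/
def reesAlg : Subalgebra R (LaurentPolynomial R) :=
  Algebra.adjoin R {x : LaurentPolynomial R | ∃ a ∈ 𝔞, C a * T 1 = x}

/-- The extended Rees algebra `T𝔞 = R[𝔞t, t⁻¹]` inside `A = R[t,t⁻¹]`. -/
def extReesAlg : Subalgebra R (LaurentPolynomial R) :=
  Algebra.adjoin R ({x : LaurentPolynomial R | ∃ a ∈ 𝔞, C a * T 1 = x} ∪ {T (-1)})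

/-- The image of the Rees algebra `S` inside `T𝔞`, as an `R`-submodule of `T𝔞`. -/
def reesInExtRees : Submodule R (extReesAlg R 𝔞) :=
  (Subalgebra.toSubmodule (reesAlg R 𝔞)).comap (extReesAlg R 𝔞).val.toLinearMap

/-- The quotient `T𝔞/S` of the extended Rees algebra by (the image of) the Rees algebra,
here as an `R`-module. -/
def TmodSR : Type _ := (extReesAlg R 𝔞) ⧸ (reesInExtRees R 𝔞)

instance : AddCommGroup (TmodSR R 𝔞) := Submodule.Quotient.addCommGroup _

instance : Module R (TmodSR R 𝔞) := Submodule.Quotient.module _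

/-- The Rees algebra in `R[t,t⁻¹]` is the image of Mathlib's Rees algebra in `R[X]`. -/
theorem reesAlg_eq_map_reesAlgebra :
    reesAlg R 𝔞 = (reesAlgebra 𝔞).map Polynomial.toLaurentAlg := by
  rw [← adjoin_monomial_eq_reesAlgebra, AlgHom.map_adjoin, reesAlg]
  congr 1
  ext x
  simp

/-- The Laurent polynomials whose coefficient of `t^i` lies in `𝔞 ^ i`, where `𝔞 ^ i` is the unit
ideal for negative `i`. -/
def coeffPowSubalgebra : Subalgebra R (LaurentPolynomial R) where
  carrier := {f | ∀ i : ℤ, f.coeff i ∈ 𝔞 ^ i.toNat}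
  mul_mem' {f g} hf hg i := by
    rw [AddMonoidAlgebra.coeff_mul]
    refine Ideal.sum_mem _ fun j _ ↦ Ideal.sum_mem _ fun k _ ↦ ?_
    dsimp only
    split_ifs with h
    · refine Ideal.pow_le_pow_right (show i.toNat ≤ j.toNat + k.toNat by omega) ?_
      rw [pow_add]
      exact Ideal.mul_mem_mul (hf j) (hg k)
    · exact Ideal.zero_mem _
  add_mem' hf hg i := Ideal.add_mem _ (hf i) (hg i)
  algebraMap_mem' r i := by
    rw [← C_eq_algebraMap, C_apply]
    split_ifs with h <;> simp [h]

theorem extReesAlg_le_coeffPowSubalgebra : extReesAlg R 𝔞 ≤ coeffPowSubalgebra R 𝔞 := by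
  refine Algebra.adjoin_le ?_
  rintro _ (⟨a, ha, rfl⟩ | rfl) i
  · rw [← single_eq_C_mul_T, AddMonoidAlgebra.coeff_single, Finsupp.single_apply]
    split_ifs with h
    · simpa [← h] using ha
    · exact Ideal.zero_mem _
  · rw [T_apply]
    split_ifs with h
    · simp [← h]
    · exact Ideal.zero_mem _

/-- The Rees algebra consists of the elements of the extended Rees algebra without terms of
negative degree. -/
theorem mem_reesAlg_iff_of_mem_extReesAlg {f : LaurentPolynomial R} (hf : f ∈ extReesAlg R 𝔞) :
    f ∈ reesAlg R 𝔞 ↔ ∀ i < 0, f.coeff i = 0 := by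
  rw [reesAlg_eq_map_reesAlgebra]
  constructor
  · rintro ⟨p, -, rfl⟩ i hi
    by_contra h
    have := Finsupp.mem_support_iff.mpr h
    simp only [RingHom.coe_coe, Polynomial.toLaurentAlg_apply, support_coeff_toLaurent,
      Finset.mem_map] at this
    obtain ⟨n, -, rfl⟩ := this
    exact absurd hi (by simp)
  · intro h
    rw [← AddMonoidAlgebra.sum_coeff_single f]
    refine Subalgebra.sum_mem _ fun i hi ↦ ?_
    obtain ⟨n, rfl⟩ := Int.eq_ofNat_of_zero_le
      (not_lt.mp fun hneg ↦ Finsupp.mem_support_iff.mp hi (h i hneg))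
    refine ⟨Polynomial.monomial n (f.coeff n), reesAlgebra.monomial_mem.mpr ?_, by simp⟩
    exact extReesAlg_le_coeffPowSubalgebra R 𝔞 hf n

theorem C_mul_T_neg_mem_extReesAlg (r : R) (n : ℕ) : C r * T (-(n : ℤ)) ∈ extReesAlg R 𝔞 := by
  have hT : (T (-1) : LaurentPolynomial R) ∈ extReesAlg R 𝔞 := Algebra.subset_adjoin (Or.inr rfl)
  have := mul_mem ((extReesAlg R 𝔞).algebraMap_mem r) (pow_mem hT n)
  rwa [T_pow, mul_neg_one, ← C_eq_algebraMap] at this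

/-- The map sending a Laurent polynomial to its coefficients of negative degree, the coefficient of
`t^(-(i+1))` being placed at index `i`. -/
def negCoeff : LaurentPolynomial R →ₗ[R] (ℕ →₀ R) :=
  Finsupp.lcomapDomain (fun i : ℕ ↦ -(i + 1 : ℤ)) (fun i j h ↦ by simpa using h) ∘ₗ
    (AddMonoidAlgebra.coeffLinearEquiv R).toLinearMap

theorem negCoeff_apply (f : LaurentPolynomial R) (i : ℕ) :
    negCoeff R f i = f.coeff (-(i + 1 : ℤ)) :=
  rfl

theorem negCoeff_C_mul_T (r : R) (i : ℕ) :
    negCoeff R (C r * T (-(i + 1 : ℤ))) = Finsupp.single i r := by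
  ext j
  rw [negCoeff_apply, ← single_eq_C_mul_T, AddMonoidAlgebra.coeff_single]
  simp [Finsupp.single_apply]

theorem negCoeff_eq_zero_iff (f : LaurentPolynomial R) :
    negCoeff R f = 0 ↔ ∀ i < 0, f.coeff i = 0 := by
  rw [Finsupp.ext_iff]
  refine ⟨fun h i hi ↦ ?_, fun h i ↦ h (-(i + 1 : ℤ)) (by omega)⟩
  have := h (-i - 1).toNat
  rwa [negCoeff_apply, show -(((-i - 1).toNat : ℤ) + 1) = i by omega] at this

theorem ker_negCoeff_comp_val :
    LinearMap.ker (negCoeff R ∘ₗ (extReesAlg R 𝔞).val.toLinearMap) = reesInExtRees R 𝔞 := by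
  ext y
  exact (negCoeff_eq_zero_iff R y).trans (mem_reesAlg_iff_of_mem_extReesAlg R 𝔞 y.2).symm

theorem negCoeff_comp_val_surjective :
    Function.Surjective (negCoeff R ∘ₗ (extReesAlg R 𝔞).val.toLinearMap) := by
  intro g
  induction g using Finsupp.induction_linear with
  | zero => exact ⟨0, map_zero _⟩
  | add g₁ g₂ h₁ h₂ =>
    obtain ⟨y₁, rfl⟩ := h₁
    obtain ⟨y₂, rfl⟩ := h₂
    exact ⟨y₁ + y₂, map_add _ _ _⟩
  | single i r =>
    have hmem := C_mul_T_neg_mem_extReesAlg R 𝔞 r (i + 1)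
    rw [Nat.cast_succ] at hmem
    exact ⟨⟨_, hmem⟩, negCoeff_C_mul_T R r i⟩

/-- As an `R`-module, the quotient `T𝔞/S` of the extended Rees algebra by
the Rees algebra is free on the monomials of negative degree: there is an `R`-linear
isomorphism `T𝔞/S ≃ (ℕ →₀ R)` sending the class of `C r * T (-(i+1))` to `r` times the
`i`-th standard basis vector. -/
theorem TmodS_free_on_negative_monomials :
    ∃ e : TmodSR R 𝔞 ≃ₗ[R] (ℕ →₀ R),
      ∀ (i : ℕ) (r : R) (y : extReesAlg R 𝔞),
        (y : LaurentPolynomial R) = C r * T (-(i + 1 : ℤ)) →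
          e (Submodule.Quotient.mk y) = Finsupp.single i r := by
  refine ⟨(Submodule.quotEquivOfEq _ _ (ker_negCoeff_comp_val R 𝔞).symm).trans
    (LinearMap.quotKerEquivOfSurjective _ (negCoeff_comp_val_surjective R 𝔞)), fun i r y hy ↦ ?_⟩
  rw [← negCoeff_C_mul_T, ← hy]
  rfl

end
end
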